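/- arXiv:1608.04246 — 3 statements merged into one kernel-verified Lean document; each statement's English description precedes it below -/
import Mathlib

section
/- Let φₙ(x) = φ(x, μₙ(q,α,β)) be the n-th eigenfunction of L(q,α,β) normalized at x = 0. If μₙ(q,α,β), viewed as a function of the boundary parameter β (with q, α, n fixed), increases, then every zero of φₙ in (0,π] moves strictly to the left (decreases); if μₙ decreases, every such zero moves strictly to the right (increases). -/
open Real MeasureTheory Set

noncomputable section

/-- `y` (with derivative `y'`) is a (Carathéodory) solution of `-y'' + q y = μ y` on `[0, π]`,
written in integral form. -/
def SLSol (q : ℝ → ℝ) (μ : ℝ) (y y' : ℝ → ℝ) : Prop :=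
  ContinuousOn y (Icc 0 π) ∧ ContinuousOn y' (Icc 0 π) ∧
  (∀ x ∈ Icc (0:ℝ) π, y x = y 0 + ∫ t in (0:ℝ)..x, y' t) ∧
  (∀ x ∈ Icc (0:ℝ) π, y' x = y' 0 + ∫ t in (0:ℝ)..x, (q t - μ) * y t)

/-- `y` (with derivative `y'`) solves the inhomogeneous equation `-y'' + q y = g + μ y`
(equivalently `y'' = (q - μ) y - g`) on `[0, π]`, in integral form.  With `g` the original
solution, this is the equation satisfied by the `μ`-derivative of a solution. -/
def SLSolInh (q : ℝ → ℝ) (μ : ℝ) (g y y' : ℝ → ℝ) : Prop :=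
  ContinuousOn y (Icc 0 π) ∧ ContinuousOn y' (Icc 0 π) ∧
  (∀ x ∈ Icc (0:ℝ) π, y x = y 0 + ∫ t in (0:ℝ)..x, y' t) ∧
  (∀ x ∈ Icc (0:ℝ) π, y' x = y' 0 + ∫ t in (0:ℝ)..x, ((q t - μ) * y t - g t))

open Filter Topology

theorem AbsolutelyContinuousOnInterval.lipschitzOnWith_comp {f g : ℝ → ℝ} {a b : ℝ} {K : NNReal}
    {t : Set ℝ} (hf : AbsolutelyContinuousOnInterval f a b) (hg : LipschitzOnWith K g t)
    (hft : MapsTo f (uIcc a b) t) : AbsolutelyContinuousOnInterval (fun x ↦ g (f x)) a b := by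
  rw [absolutelyContinuousOnInterval_iff] at hf ⊢
  intro ε hε
  obtain ⟨δ, hδ, h⟩ := hf (ε / (K + 1)) (by positivity)
  refine ⟨δ, hδ, fun E hE hlen ↦ ?_⟩
  have hsum := h E hE hlen
  have hle : ∑ i ∈ Finset.range E.1, dist (g (f (E.2 i).1)) (g (f (E.2 i).2)) ≤
      K * ∑ i ∈ Finset.range E.1, dist (f (E.2 i).1) (f (E.2 i).2) := by
    rw [Finset.mul_sum]
    refine Finset.sum_le_sum fun i hi ↦ ?_
    have hmem := hE.1 i hi
    exact hg.dist_le_mul _ (hft hmem.1) _ (hft hmem.2)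
  have hnn : 0 ≤ ∑ i ∈ Finset.range E.1, dist (f (E.2 i).1) (f (E.2 i).2) :=
    Finset.sum_nonneg fun _ _ ↦ dist_nonneg
  rw [lt_div_iff₀ (by positivity)] at hsum
  nlinarith

theorem AbsolutelyContinuousOnInterval.exp {f : ℝ → ℝ} {a b : ℝ}
    (hf : AbsolutelyContinuousOnInterval f a b) :
    AbsolutelyContinuousOnInterval (fun x ↦ Real.exp (f x)) a b := by
  obtain ⟨C, hC⟩ := hf.exists_bound
  have hlip : LipschitzOnWith (Real.exp C).toNNReal Real.exp (Iic C) := by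
    refine Convex.lipschitzOnWith_of_nnnorm_deriv_le (fun _ _ ↦ Real.differentiableAt_exp)
      (fun x hx ↦ ?_) (convex_Iic C)
    rw [← NNReal.coe_le_coe, Real.coe_toNNReal _ (Real.exp_pos C).le, Real.deriv_exp]
    simpa using hx
  exact hf.lipschitzOnWith_comp hlip fun x hx ↦ (le_abs_self _).trans (hC x hx)

/-- An antiderivative with prescribed initial value is absolutely continuous. -/
theorem absolutelyContinuousOnInterval_const_add_integral {g : ℝ → ℝ} {b : ℝ}
    (hg : IntervalIntegrable g volume 0 b) (c : ℝ) :
    AbsolutelyContinuousOnInterval (fun x ↦ c + ∫ t in (0:ℝ)..x, g t) 0 b := by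
  have hc : AbsolutelyContinuousOnInterval (fun _ : ℝ ↦ c) 0 b :=
    ((LipschitzWith.const c).lipschitzOnWith (s := uIcc 0 b)).absolutelyContinuousOnInterval
  exact hc.fun_add (hg.absolutelyContinuousOnInterval_intervalIntegral (by simp))

/-- Integration by parts for two functions given as antiderivatives. -/
theorem integral_deriv_mul_eq_sub_of_eq_integral {y g z h : ℝ → ℝ} {b : ℝ} (hb : 0 ≤ b)
    (hg : IntervalIntegrable g volume 0 b) (hh : IntervalIntegrable h volume 0 b)
    (hy : ∀ x ∈ Icc 0 b, y x = y 0 + ∫ t in (0:ℝ)..x, g t)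
    (hz : ∀ x ∈ Icc 0 b, z x = z 0 + ∫ t in (0:ℝ)..x, h t) :
    ∫ x in (0:ℝ)..b, (g x * z x + y x * h x) = y b * z b - y 0 * z 0 := by
  have key := (absolutelyContinuousOnInterval_const_add_integral hg
    (y 0)).integral_deriv_mul_eq_sub (absolutelyContinuousOnInterval_const_add_integral hh (z 0))
  rw [← hy b (right_mem_Icc.2 hb), ← hz b (right_mem_Icc.2 hb)] at key
  simp only [intervalIntegral.integral_same, add_zero] at key
  rw [← key]
  refine intervalIntegral.integral_congr_ae ?_
  filter_upwards [hg.ae_hasDerivAt_integral, hh.ae_hasDerivAt_integral] with x hx₁ hx₂ hx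
  have hx' : x ∈ uIcc 0 b := uIoc_subset_uIcc hx
  have hxI : x ∈ Icc 0 b := by rwa [uIcc_of_le hb] at hx'
  rw [((hx₁ hx' 0 (by simp)).const_add (y 0)).deriv, ((hx₂ hx' 0 (by simp)).const_add (z 0)).deriv,
    ← hy x hxI, ← hz x hxI]

/-- **Grönwall's inequality** in integral form, with an integrable coefficient. -/
theorem le_mul_exp_integral_of_le_add_integral {k u : ℝ → ℝ} {b ε : ℝ} (hb : 0 ≤ b)
    (hk : IntervalIntegrable k volume 0 b) (hk0 : ∀ x, 0 ≤ k x) (hu : ContinuousOn u (Icc 0 b))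
    (hle : ∀ x ∈ Icc 0 b, u x ≤ ε + ∫ t in (0:ℝ)..x, k t * u t) :
    u b ≤ ε * Real.exp (∫ t in (0:ℝ)..b, k t) := by
  have hku : IntervalIntegrable (fun t ↦ k t * u t) volume 0 b :=
    hk.mul_continuousOn (by rwa [uIcc_of_le hb])
  have hE := ((absolutelyContinuousOnInterval_const_add_integral hk 0).fun_neg).exp
  have hU := absolutelyContinuousOnInterval_const_add_integral hku ε
  have key := hE.integral_deriv_mul_eq_sub hU
  have hneg : ∫ x in (0:ℝ)..b, (deriv (fun x ↦ Real.exp (-(0 + ∫ t in (0:ℝ)..x, k t))) x *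
      (ε + ∫ t in (0:ℝ)..x, k t * u t) + Real.exp (-(0 + ∫ t in (0:ℝ)..x, k t)) *
      deriv (fun x ↦ ε + ∫ t in (0:ℝ)..x, k t * u t) x) ≤ 0 := by
    rw [intervalIntegral.integral_of_le hb]
    refine integral_nonpos_of_ae ?_
    rw [EventuallyLE, ae_restrict_iff' measurableSet_Ioc]
    filter_upwards [hk.ae_hasDerivAt_integral, hku.ae_hasDerivAt_integral] with x hx₁ hx₂ hx
    have hxI : x ∈ Icc 0 b := Ioc_subset_Icc_self hx
    have hx' : x ∈ uIcc 0 b := by rwa [uIcc_of_le hb]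
    rw [(((hx₁ hx' 0 (by simp)).const_add 0).fun_neg.exp).deriv,
      ((hx₂ hx' 0 (by simp)).const_add ε).deriv]
    have h1 := mul_nonneg (Real.exp_pos (-(0 + ∫ t in (0:ℝ)..x, k t))).le
      (mul_nonneg (hk0 x) (sub_nonneg.2 (hle x hxI)))
    simp only [Pi.zero_apply]
    nlinarith
  rw [key] at hneg
  simp only [intervalIntegral.integral_same, add_zero, zero_add, neg_zero, Real.exp_zero,
    one_mul, sub_nonpos] at hneg
  refine (hle b (right_mem_Icc.2 hb)).trans ?_
  rw [Real.exp_neg, inv_mul_le_iff₀ (Real.exp_pos _)] at hneg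
  linarith

section SturmLiouville

variable {q : ℝ → ℝ} {μ₀ μ₁ : ℝ} {y₀ y₀' y₁ y₁' : ℝ → ℝ}

theorem SLSol.intervalIntegrable_sub_mul (hq : IntervalIntegrable q volume 0 π)
    (h : SLSol q μ₀ y₀ y₀') {x : ℝ} (hx : x ∈ Icc 0 π) :
    IntervalIntegrable (fun t ↦ (q t - μ₀) * y₀ t) volume 0 x := by
  have hsub : uIcc 0 x ⊆ uIcc 0 π := by
    rw [uIcc_of_le hx.1, uIcc_of_le pi_pos.le]; exact Icc_subset_Icc_right hx.2
  refine ((hq.mono_set hsub).sub intervalIntegrable_const).mul_continuousOn ?_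
  exact h.1.mono (by rwa [uIcc_of_le pi_pos.le] at hsub)

theorem ContinuousOn.intervalIntegrable_zero_pi {u : ℝ → ℝ} (hu : ContinuousOn u (Icc 0 π)) {x : ℝ}
    (hx : x ∈ Icc 0 π) : IntervalIntegrable u volume 0 x :=
  (hu.mono (Icc_subset_Icc_right hx.2)).intervalIntegrable_of_Icc hx.1

/-- Integration by parts for `y₀ y₁'`. -/
theorem SLSol.integral_parts (hq : IntervalIntegrable q volume 0 π)
    (h₀ : SLSol q μ₀ y₀ y₀') (h₁ : SLSol q μ₁ y₁ y₁') {x : ℝ} (hx : x ∈ Icc 0 π) :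
    ∫ t in (0:ℝ)..x, (y₀' t * y₁' t + y₀ t * ((q t - μ₁) * y₁ t)) =
      y₀ x * y₁' x - y₀ 0 * y₁' 0 :=
  integral_deriv_mul_eq_sub_of_eq_integral hx.1 (h₀.2.1.intervalIntegrable_zero_pi hx)
    (h₁.intervalIntegrable_sub_mul hq hx) (fun t ht ↦ h₀.2.2.1 t ⟨ht.1, ht.2.trans hx.2⟩)
    (fun t ht ↦ h₁.2.2.2 t ⟨ht.1, ht.2.trans hx.2⟩)

/-- Lagrange's identity for two solutions with the same initial values. -/
theorem SLSol.wronskian_eq (hq : IntervalIntegrable q volume 0 π)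
    (h₀ : SLSol q μ₀ y₀ y₀') (h₁ : SLSol q μ₁ y₁ y₁')
    (e : y₁ 0 = y₀ 0) (e' : y₁' 0 = y₀' 0) {x : ℝ} (hx : x ∈ Icc 0 π) :
    y₀' x * y₁ x - y₀ x * y₁' x = (μ₁ - μ₀) * ∫ t in (0:ℝ)..x, y₀ t * y₁ t := by
  have a := h₀.integral_parts hq h₁ hx
  have b := h₁.integral_parts hq h₀ hx
  have hsub : Icc 0 x ⊆ Icc 0 π := Icc_subset_Icc_right hx.2
  have hI : ∀ {u v : ℝ → ℝ}, ContinuousOn u (Icc 0 π) → IntervalIntegrable v volume 0 x →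
      IntervalIntegrable (fun t ↦ u t * v t) volume 0 x := fun hu hv ↦
    hv.continuousOn_mul (by rw [uIcc_of_le hx.1]; exact hu.mono hsub)
  have i₁ := (hI h₀.2.1 (h₁.2.1.intervalIntegrable_zero_pi hx)).add
    (hI h₀.1 (h₁.intervalIntegrable_sub_mul hq hx))
  have i₂ := (hI h₁.2.1 (h₀.2.1.intervalIntegrable_zero_pi hx)).add
    (hI h₁.1 (h₀.intervalIntegrable_sub_mul hq hx))
  have hs := intervalIntegral.integral_sub i₂ i₁
  rw [a, b, e, e'] at hs
  rw [← intervalIntegral.integral_const_mul]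
  have hc : ∫ t in (0:ℝ)..x, (μ₁ - μ₀) * (y₀ t * y₁ t) = ∫ t in (0:ℝ)..x,
      (y₁' t * y₀' t + y₁ t * ((q t - μ₀) * y₀ t) -
        (y₀' t * y₁' t + y₀ t * ((q t - μ₁) * y₁ t))) := by
    congr 1; ext t; ring
  rw [hc, hs]; ring

/-- Solutions with the same initial values depend in a Lipschitz way on the spectral parameter. -/
theorem SLSol.abs_sub_le (hq : IntervalIntegrable q volume 0 π)
    (h₀ : SLSol q μ₀ y₀ y₀') (h₁ : SLSol q μ₁ y₁ y₁')
    (e : y₁ 0 = y₀ 0) (e' : y₁' 0 = y₀' 0) (hμ : |μ₁ - μ₀| ≤ 1) {x : ℝ} (hx : x ∈ Icc 0 π) :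
    |y₁ x - y₀ x| + |y₁' x - y₀' x| ≤ |μ₁ - μ₀| * ((∫ t in (0:ℝ)..π, |y₀ t|) *
      Real.exp (∫ t in (0:ℝ)..π, (|q t| + (|μ₀| + 2)))) := by
  have hk : IntervalIntegrable (fun t ↦ |q t| + (|μ₀| + 2)) volume 0 π :=
    hq.abs.add intervalIntegrable_const
  have hπ : π ∈ Icc (0:ℝ) π := right_mem_Icc.2 pi_pos.le
  have hmono : ∀ {v : ℝ → ℝ} {s : ℝ}, IntervalIntegrable v volume 0 π → s ∈ Icc 0 π →
      IntervalIntegrable v volume 0 s := fun hv hs ↦ hv.mono_set (by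
    rw [uIcc_of_le hs.1, uIcc_of_le pi_pos.le]; exact Icc_subset_Icc_right hs.2)
  have hle : ∀ {v : ℝ → ℝ} {s : ℝ}, (∀ t, 0 ≤ v t) → IntervalIntegrable v volume 0 π →
      s ∈ Icc 0 π → ∫ t in (0:ℝ)..s, v t ≤ ∫ t in (0:ℝ)..π, v t := fun hv hi hs ↦
    intervalIntegral.integral_mono_interval le_rfl hs.1 hs.2
      (Eventually.of_forall hv) hi
  have hu : ContinuousOn (fun t ↦ |y₁ t - y₀ t| + |y₁' t - y₀' t|) (Icc 0 π) :=
    (h₁.1.sub h₀.1).abs.add (h₁.2.1.sub h₀.2.1).abs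
  have hA : IntervalIntegrable (fun t ↦ |y₀ t|) volume 0 π := h₀.1.abs.intervalIntegrable_zero_pi hπ
  have hA0 : 0 ≤ ∫ t in (0:ℝ)..π, |y₀ t| :=
    intervalIntegral.integral_nonneg pi_pos.le fun _ _ ↦ abs_nonneg _
  have hest : ∀ s ∈ Icc 0 π, |y₁ s - y₀ s| + |y₁' s - y₀' s| ≤
      |μ₁ - μ₀| * (∫ t in (0:ℝ)..π, |y₀ t|) +
        ∫ t in (0:ℝ)..s, (|q t| + (|μ₀| + 2)) * (|y₁ t - y₀ t| + |y₁' t - y₀' t|) := by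
    intro s hs
    have d₁ : y₁ s - y₀ s = ∫ t in (0:ℝ)..s, (y₁' t - y₀' t) := by
      rw [h₁.2.2.1 s hs, h₀.2.2.1 s hs, intervalIntegral.integral_sub
        (h₁.2.1.intervalIntegrable_zero_pi hs) (h₀.2.1.intervalIntegrable_zero_pi hs), e]
      ring
    have d₂ : y₁' s - y₀' s = ∫ t in (0:ℝ)..s, ((q t - μ₁) * y₁ t - (q t - μ₀) * y₀ t) := by
      rw [h₁.2.2.2 s hs, h₀.2.2.2 s hs, intervalIntegral.integral_sub
        (h₁.intervalIntegrable_sub_mul hq hs) (h₀.intervalIntegrable_sub_mul hq hs), e']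
      ring
    have j₁ := ((h₁.2.1.sub h₀.2.1).intervalIntegrable_zero_pi hs).abs
    have j₂ := ((h₁.intervalIntegrable_sub_mul hq hs).sub (h₀.intervalIntegrable_sub_mul hq hs)).abs
    have j₃ := (hmono hA hs).const_mul |μ₁ - μ₀|
    have j₄ : IntervalIntegrable (fun t ↦ (|q t| + (|μ₀| + 2)) *
        (|y₁ t - y₀ t| + |y₁' t - y₀' t|)) volume 0 s :=
      (hmono hk hs).mul_continuousOn (by
        rw [uIcc_of_le hs.1]; exact hu.mono (Icc_subset_Icc_right hs.2))
    calc |y₁ s - y₀ s| + |y₁' s - y₀' s|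
        ≤ (∫ t in (0:ℝ)..s, |y₁' t - y₀' t|) +
          ∫ t in (0:ℝ)..s, |(q t - μ₁) * y₁ t - (q t - μ₀) * y₀ t| := by
          rw [d₁, d₂]
          exact add_le_add (intervalIntegral.abs_integral_le_integral_abs hs.1)
            (intervalIntegral.abs_integral_le_integral_abs hs.1)
      _ = ∫ t in (0:ℝ)..s, (|y₁' t - y₀' t| + |(q t - μ₁) * y₁ t - (q t - μ₀) * y₀ t|) :=
          (intervalIntegral.integral_add j₁ j₂).symm
      _ ≤ ∫ t in (0:ℝ)..s, (|μ₁ - μ₀| * |y₀ t| +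
            (|q t| + (|μ₀| + 2)) * (|y₁ t - y₀ t| + |y₁' t - y₀' t|)) := by
          refine intervalIntegral.integral_mono_on hs.1 (j₁.add j₂) (j₃.add j₄) fun t _ ↦ ?_
          have e₁ : (q t - μ₁) * y₁ t - (q t - μ₀) * y₀ t =
              (q t - μ₁) * (y₁ t - y₀ t) - (μ₁ - μ₀) * y₀ t := by ring
          have e₂ : |(q t - μ₁) * y₁ t - (q t - μ₀) * y₀ t| ≤
              |q t - μ₁| * |y₁ t - y₀ t| + |μ₁ - μ₀| * |y₀ t| := by
            rw [e₁, ← abs_mul, ← abs_mul]; exact abs_sub _ _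
          have e₃ : |q t - μ₁| ≤ |q t| + (|μ₀| + 1) := by
            have := abs_sub (q t) μ₁
            have := abs_sub_abs_le_abs_sub μ₁ μ₀
            linarith
          nlinarith [abs_nonneg (y₁ t - y₀ t), abs_nonneg (y₁' t - y₀' t), abs_nonneg (q t),
            abs_nonneg μ₀, mul_le_mul_of_nonneg_right e₃ (abs_nonneg (y₁ t - y₀ t)),
            mul_nonneg (abs_nonneg (q t)) (abs_nonneg (y₁' t - y₀' t)),
            mul_nonneg (abs_nonneg μ₀) (abs_nonneg (y₁' t - y₀' t))]
      _ = |μ₁ - μ₀| * (∫ t in (0:ℝ)..s, |y₀ t|) +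
            ∫ t in (0:ℝ)..s, (|q t| + (|μ₀| + 2)) * (|y₁ t - y₀ t| + |y₁' t - y₀' t|) := by
          rw [intervalIntegral.integral_add j₃ j₄, intervalIntegral.integral_const_mul]
      _ ≤ _ := by
          have := mul_le_mul_of_nonneg_left (hle (fun t ↦ abs_nonneg (y₀ t)) hA hs)
            (abs_nonneg (μ₁ - μ₀))
          linarith
  have hk0 : ∀ t, 0 ≤ |q t| + (|μ₀| + 2) := fun t ↦ by positivity
  have hgron := le_mul_exp_integral_of_le_add_integral hx.1 (hmono hk hx) hk0
    (hu.mono (Icc_subset_Icc_right hx.2)) fun s hs ↦ hest s ⟨hs.1, hs.2.trans hx.2⟩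
  refine hgron.trans ?_
  rw [← mul_assoc]
  exact mul_le_mul_of_nonneg_left (Real.exp_le_exp.2 (hle hk0 hk hx)) (by positivity)

/-- A solution with nontrivial initial values has positive `L²` norm on every `[0, x]`. -/
theorem SLSol.integral_sq_pos (hq : IntervalIntegrable q volume 0 π) (h₀ : SLSol q μ₀ y₀ y₀')
    (hne : y₀ 0 ≠ 0 ∨ y₀' 0 ≠ 0) {x : ℝ} (hx : x ∈ Ioc 0 π) :
    0 < ∫ t in (0:ℝ)..x, y₀ t * y₀ t := by
  have hxI : x ∈ Icc 0 π := Ioc_subset_Icc_self hx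
  have hsub : Icc 0 x ⊆ Icc 0 π := Icc_subset_Icc_right hx.2
  have h0 : (0:ℝ) ∈ Icc 0 x := left_mem_Icc.2 hx.1.le
  refine intervalIntegral.integral_pos hx.1 ((h₀.1.mul h₀.1).mono hsub)
    (fun t _ ↦ mul_self_nonneg _) ?_
  by_contra! hcon
  have hz : ∀ t ∈ Icc 0 x, y₀ t = 0 := fun t ht ↦
    mul_self_eq_zero.1 (le_antisymm (hcon t ht) (mul_self_nonneg _))
  have hd : y₀' 0 ≠ 0 := hne.resolve_left (not_not.2 (hz 0 h0))
  have hpos : 0 < ∫ t in (0:ℝ)..x, y₀' t * y₀' t :=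
    intervalIntegral.integral_pos hx.1 ((h₀.2.1.mul h₀.2.1).mono hsub)
      (fun t _ ↦ mul_self_nonneg _) ⟨0, h0, mul_self_pos.2 hd⟩
  have hparts := h₀.integral_parts hq h₀ hxI
  rw [hz 0 h0, hz x (right_mem_Icc.2 hx.1.le)] at hparts
  have hc : ∫ t in (0:ℝ)..x, (y₀' t * y₀' t + y₀ t * ((q t - μ₀) * y₀ t)) =
      ∫ t in (0:ℝ)..x, y₀' t * y₀' t := by
    refine intervalIntegral.integral_congr fun t ht ↦ ?_
    rw [uIcc_of_le hx.1.le] at ht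
    simp [hz t ht]
  rw [hc] at hparts
  linarith

/-- Near a zero `x₀` of the solution for `μ₀`, zeros of the solution for `μ` lie to the left of
`x₀` if `μ > μ₀` and to the right if `μ < μ₀`. -/
theorem exists_zero_moves_opposite {f fx : ℝ → ℝ → ℝ} (hq : IntervalIntegrable q volume 0 π)
    (hsol : ∀ μ, SLSol q μ (f μ) (fx μ)) {c d : ℝ} (hinit : ∀ μ, f μ 0 = c ∧ fx μ 0 = d)
    (hcd : c ≠ 0 ∨ d ≠ 0) {x₀ : ℝ} (hx₀ : x₀ ∈ Ioc 0 π) (hzero : f μ₀ x₀ = 0) :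
    ∃ r > 0, ∀ μ, ∀ x ∈ Ioc 0 π, |μ - μ₀| < r → |x - x₀| < r → f μ x = 0 →
      (μ₀ < μ → x < x₀) ∧ (μ < μ₀ → x₀ < x) := by
  have hx₀I : x₀ ∈ Icc 0 π := Ioc_subset_Icc_self hx₀
  have h₀ := hsol μ₀
  have hJ : 0 < ∫ t in (0:ℝ)..x₀, f μ₀ t * f μ₀ t :=
    h₀.integral_sq_pos hq (by rwa [(hinit μ₀).1, (hinit μ₀).2]) hx₀
  set J := ∫ t in (0:ℝ)..x₀, f μ₀ t * f μ₀ t with hJdef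
  have e : ∀ μ, f μ 0 = f μ₀ 0 := fun μ ↦ by rw [(hinit μ).1, (hinit μ₀).1]
  have e' : ∀ μ, fx μ 0 = fx μ₀ 0 := fun μ ↦ by rw [(hinit μ).2, (hinit μ₀).2]
  obtain ⟨C, hC0, hC⟩ : ∃ C, 0 ≤ C ∧ ∀ μ, |μ - μ₀| ≤ 1 → ∀ x ∈ Icc 0 π,
      |f μ x - f μ₀ x| + |fx μ x - fx μ₀ x| ≤ |μ - μ₀| * C :=
    ⟨_, mul_nonneg (intervalIntegral.integral_nonneg pi_pos.le fun _ _ ↦ abs_nonneg _)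
      (Real.exp_pos _).le, fun μ hμ x hx ↦ h₀.abs_sub_le hq (hsol μ) (e μ) (e' μ) hμ hx⟩
  have hA0 : 0 ≤ ∫ t in (0:ℝ)..x₀, |f μ₀ t| :=
    intervalIntegral.integral_nonneg hx₀.1.le fun _ _ ↦ abs_nonneg _
  set A := ∫ t in (0:ℝ)..x₀, |f μ₀ t| with hAdef
  have hI : ∀ μ, |μ - μ₀| ≤ 1 → J - |μ - μ₀| * C * A ≤ ∫ t in (0:ℝ)..x₀, f μ₀ t * f μ t := by
    intro μ hμ
    have i₁ : IntervalIntegrable (fun t ↦ f μ₀ t * f μ₀ t) volume 0 x₀ :=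
      (h₀.1.mul h₀.1).intervalIntegrable_zero_pi hx₀I
    have i₂ := (h₀.1.abs.intervalIntegrable_zero_pi hx₀I).const_mul (|μ - μ₀| * C)
    rw [hJdef, hAdef, ← intervalIntegral.integral_const_mul,
      ← intervalIntegral.integral_sub i₁ i₂]
    refine intervalIntegral.integral_mono_on hx₀.1.le (i₁.sub i₂)
      ((h₀.1.mul (hsol μ).1).intervalIntegrable_zero_pi hx₀I) fun t ht ↦ ?_
    have hb : |f μ t - f μ₀ t| ≤ |μ - μ₀| * C :=
      (le_add_of_nonneg_right (abs_nonneg _)).trans (hC μ hμ t ⟨ht.1, ht.2.trans hx₀.2⟩)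
    have h1 := neg_abs_le (f μ₀ t * (f μ t - f μ₀ t))
    rw [abs_mul] at h1
    nlinarith [mul_le_mul_of_nonneg_left hb (abs_nonneg (f μ₀ t))]
  have hW : ∀ μ, fx μ₀ x₀ * f μ x₀ = (μ - μ₀) * ∫ t in (0:ℝ)..x₀, f μ₀ t * f μ t := by
    intro μ
    have := h₀.wronskian_eq hq (hsol μ) (e μ) (e' μ) hx₀I
    rwa [hzero, zero_mul, sub_zero] at this
  obtain ⟨r₁, hr₁, hr₁1, hr₁J⟩ : ∃ r > 0, r ≤ 1 ∧ r * C * A < J := by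
    refine ⟨min 1 (J / (C * A + 1)), by positivity, min_le_left _ _, ?_⟩
    have hCA : 0 ≤ C * A := mul_nonneg hC0 hA0
    have h1 : J / (C * A + 1) * (C * A + 1) = J := by field_simp
    have h2 : min 1 (J / (C * A + 1)) ≤ J / (C * A + 1) := min_le_right _ _
    have h3 : 0 < J / (C * A + 1) := by positivity
    nlinarith
  have hIpos : ∀ μ, |μ - μ₀| ≤ r₁ → 0 < ∫ t in (0:ℝ)..x₀, f μ₀ t * f μ t := by
    intro μ hμ
    have := hI μ (hμ.trans hr₁1)
    have := mul_le_mul_of_nonneg_right hμ (mul_nonneg hC0 hA0)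
    linarith
  have hd : fx μ₀ x₀ ≠ 0 := by
    intro hd
    have h1 := hW (μ₀ + r₁)
    have h2 := hIpos (μ₀ + r₁) (by rw [add_sub_cancel_left, abs_of_pos hr₁])
    rw [hd, zero_mul, add_sub_cancel_left] at h1
    exact (mul_pos hr₁ h2).ne h1
  have hdpos : 0 < |fx μ₀ x₀| := abs_pos.2 hd
  obtain ⟨δ, hδ, hcont⟩ := Metric.continuousOn_iff.1 h₀.2.1 x₀ hx₀I (|fx μ₀ x₀| / 2) (by positivity)
  refine ⟨min r₁ (min δ (|fx μ₀ x₀| / (2 * (C + 1)))), by positivity, ?_⟩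
  intro μ x hx hμ hxx hfx
  simp only [lt_min_iff] at hμ hxx
  obtain ⟨hμ₁, -, hμ₂⟩ := hμ
  have hxδ := hxx.2.1
  have hpos := hIpos μ hμ₁.le
  have hxI : x ∈ Icc 0 π := Ioc_subset_Icc_self hx
  have hsign : ∀ t ∈ uIcc x₀ x, 0 ≤ fx μ₀ x₀ * fx μ t := by
    intro t ht
    have htI : t ∈ Icc 0 π := (uIcc_subset_Icc hx₀I hxI) ht
    have htx : |t - x₀| < δ := (abs_sub_left_of_mem_uIcc ht).trans_lt hxδ
    have h1 := hcont t htI (by rwa [Real.dist_eq])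
    rw [Real.dist_eq] at h1
    have h2 : |fx μ t - fx μ₀ t| ≤ |μ - μ₀| * C :=
      (le_add_of_nonneg_left (abs_nonneg _)).trans (hC μ (hμ₁.le.trans hr₁1) t htI)
    rw [lt_div_iff₀ (by positivity)] at hμ₂
    have h3 : |fx μ t - fx μ₀ x₀| ≤ |fx μ₀ x₀| := by
      have := abs_sub_le (fx μ t) (fx μ₀ t) (fx μ₀ x₀)
      nlinarith [abs_nonneg (μ - μ₀)]
    have h4 := sq_le_sq.2 h3
    nlinarith [sq_nonneg (fx μ t)]
  have hftc : f μ x₀ = - ∫ t in x₀..x, fx μ t := by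
    have h1 := (hsol μ).2.2.1 x hxI
    have h2 := (hsol μ).2.2.1 x₀ hx₀I
    have h3 := intervalIntegral.integral_interval_sub_left
      ((hsol μ).2.1.intervalIntegrable_zero_pi hxI) ((hsol μ).2.1.intervalIntegrable_zero_pi hx₀I)
    linarith
  have hWμ := hW μ
  rw [hftc, mul_neg, ← intervalIntegral.integral_const_mul] at hWμ
  constructor
  · intro hlt
    by_contra! hge
    have h1 := intervalIntegral.integral_nonneg (μ := volume) hge fun t ht ↦
      hsign t (Icc_subset_uIcc ht)
    have h2 := mul_pos (sub_pos.2 hlt) hpos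
    linarith
  · intro hlt
    by_contra! hge
    have h1 := intervalIntegral.integral_nonneg (μ := volume) hge fun t ht ↦
      hsign t (Icc_subset_uIcc' ht)
    rw [intervalIntegral.integral_symm] at h1
    have h2 := mul_pos (sub_pos.2 hlt) hpos
    linarith

end SturmLiouville

/-- A continuous function on an interval that is locally larger to the left of every point is
strictly decreasing. -/
theorem ContinuousOn.strictAntiOn_of_eventually_lt {X : ℝ → ℝ} {s : Set ℝ} (hs : s.OrdConnected)
    (hX : ContinuousOn X s) (h : ∀ b ∈ s, ∀ᶠ t in 𝓝[s] b, t < b → X b < X t) :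
    StrictAntiOn X s := by
  intro a ha b hb hab
  have hsub : Icc a b ⊆ s := hs.out ha hb
  have hne : ∀ c ∈ Ioc a b, ∃ t ∈ Icc a b, X c < X t := by
    intro c hc
    have hev : ∀ᶠ t in 𝓝[<] c, t ∈ Icc a b := by
      filter_upwards [Ioo_mem_nhdsLT hc.1] with t ht using ⟨ht.1.le, ht.2.le.trans hc.2⟩
    have hle : 𝓝[<] c ≤ 𝓝[s] c :=
      le_inf nhdsWithin_le_nhds (le_principal_iff.2 (hev.mono hsub))
    have hlt : ∀ᶠ t in 𝓝[<] c, t < c := eventually_mem_nhdsWithin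
    obtain ⟨t, ht, htc, hX⟩ :=
      (hev.and (hlt.and ((h c (hsub (Ioc_subset_Icc_self hc))).filter_mono hle))).exists
    exact ⟨t, ht, hX htc⟩
  obtain ⟨c, hc, hmax⟩ := isCompact_Icc.exists_isMaxOn (nonempty_Icc.2 hab.le) (hX.mono hsub)
  have hca : c = a := by
    by_contra hca
    obtain ⟨t, ht, hlt⟩ := hne c ⟨lt_of_le_of_ne hc.1 (Ne.symm hca), hc.2⟩
    exact (hmax ht).not_gt hlt
  obtain ⟨t, ht, hlt⟩ := hne b ⟨hab, le_rfl⟩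
  exact hlt.trans_le (hca ▸ hmax ht)

/-- Let `f μ` be the solution family normalized at `0` (`f μ 0 = sin α`, `fx μ 0 = -cos α`),
and let `X β ∈ (0, π]` be a continuous curve of zeros of `f (M β)`, where `M β = μₙ(q,α,β)`
depends continuously on the boundary parameter `β` on an interval `s`.  If `M` strictly
increases then every zero strictly moves to the left, and if `M` strictly decreases then
every zero strictly moves to the right. -/
theorem zeros_move_opposite_to_eigenvalue
    (q : ℝ → ℝ) (hq : IntervalIntegrable q volume 0 π)
    (α : ℝ) (hα : α ∈ Ioc (0:ℝ) π)
    (f fx : ℝ → ℝ → ℝ)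
    (hsol : ∀ μ : ℝ, SLSol q μ (f μ) (fx μ))
    (hinit : ∀ μ : ℝ, f μ 0 = sin α ∧ fx μ 0 = -cos α)
    (s : Set ℝ) (hs : s.OrdConnected)
    (M X : ℝ → ℝ)
    (hM : ContinuousOn M s) (hXc : ContinuousOn X s)
    (hXmem : ∀ β ∈ s, X β ∈ Ioc (0:ℝ) π)
    (hXzero : ∀ β ∈ s, f (M β) (X β) = 0) :
    (StrictMonoOn M s → StrictAntiOn X s) ∧
    (StrictAntiOn M s → StrictMonoOn X s) := by
  have hcd : sin α ≠ 0 ∨ -cos α ≠ 0 := by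
    by_contra! h
    nlinarith [sin_sq_add_cos_sq α]
  have hloc : ∀ b ∈ s, ∀ᶠ t in 𝓝[s] b,
      (M b < M t → X t < X b) ∧ (M t < M b → X b < X t) := by
    intro b hb
    obtain ⟨r, hr, h⟩ := exists_zero_moves_opposite hq hsol hinit hcd (hXmem b hb) (hXzero b hb)
    filter_upwards [hM b hb (Metric.ball_mem_nhds (M b) hr),
      hXc b hb (Metric.ball_mem_nhds (X b) hr), self_mem_nhdsWithin] with t h₁ h₂ ht
    exact h (M t) (X t) (hXmem t ht) h₁ h₂ (hXzero t ht)
  refine ⟨fun hmono ↦ hXc.strictAntiOn_of_eventually_lt hs fun b hb ↦ ?_, fun hanti ↦ ?_⟩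
  · filter_upwards [hloc b hb, self_mem_nhdsWithin] with t h ht hlt
    exact h.2 (hmono ht hb hlt)
  · have hneg : StrictAntiOn (fun b ↦ -X b) s :=
      hXc.neg.strictAntiOn_of_eventually_lt hs fun b hb ↦ by
        filter_upwards [hloc b hb, self_mem_nhdsWithin] with t h ht hlt
        exact neg_lt_neg (h.1 (hanti ht hb hlt))
    exact fun a ha b hb hab ↦ neg_lt_neg_iff.1 (hneg ha hb hab)
end
end

section
/- For fixed q ∈ L¹([0,π]; ℝ) and fixed α ∈ (0,π], the n-th eigenvalue μₙ(q, α, β) of L(q, α, β) is strictly decreasing and continuous in β ∈ [0,π), and lim_{β→π⁻} μₙ(q, α, β) = μ_{n-1}(q, α, 0) for n ≥ 1. -/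
open Real MeasureTheory Set

noncomputable section

/-- `y` (with derivative `y'`) is an eigenfunction of the Sturm–Liouville problem
`L(q, α, β)` with eigenvalue `μ`. -/
def IsEigenpair (q : ℝ → ℝ) (α β μ : ℝ) (y y' : ℝ → ℝ) : Prop :=
  SLSol q μ y y' ∧ (∃ x ∈ Icc (0:ℝ) π, y x ≠ 0) ∧
  y 0 * Real.cos α + y' 0 * Real.sin α = 0 ∧
  y π * Real.cos β + y' π * Real.sin β = 0

/-- `μ` is an eigenvalue of the Sturm–Liouville problem `L(q, α, β)`. -/
def IsEigenvalue (q : ℝ → ℝ) (α β μ : ℝ) : Prop :=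
  ∃ y y', IsEigenpair q α β μ y y'

lemma intervalIntegrable_of_continuousOn {f : ℝ → ℝ} (hf : ContinuousOn f (Icc 0 π)) :
    IntervalIntegrable f volume 0 π :=
  ContinuousOn.intervalIntegrable (by rwa [uIcc_of_le pi_pos.le])

/-- `F` is absolutely continuous on `[0, π]` with integrable a.e. derivative `f`, in integral
form. -/
def IsPrimitive (F f : ℝ → ℝ) : Prop :=
  IntervalIntegrable f volume 0 π ∧ ∀ x ∈ Icc (0:ℝ) π, F x = F 0 + ∫ t in (0:ℝ)..x, f t

namespace IsPrimitive

variable {F G f g : ℝ → ℝ}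

lemma intervalIntegrable_of_mem (hf : IntervalIntegrable f volume 0 π) {x : ℝ}
    (hx : x ∈ Icc (0:ℝ) π) : IntervalIntegrable f volume 0 x :=
  hf.mono_set (uIcc_subset_uIcc_left (by rwa [uIcc_of_le pi_pos.le]))

lemma continuousOn (hF : IsPrimitive F f) : ContinuousOn F (Icc 0 π) := by
  have h := intervalIntegral.continuousOn_primitive_interval' hF.1 left_mem_uIcc
  rw [uIcc_of_le pi_pos.le] at h
  exact (continuousOn_const.add h).congr hF.2

lemma congr_deriv (hF : IsPrimitive F f) (h : ∀ x, f x = g x) : IsPrimitive F g := by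
  rwa [← funext h]

lemma sub (hF : IsPrimitive F f) (hG : IsPrimitive G g) :
    IsPrimitive (fun x => F x - G x) (fun x => f x - g x) := by
  refine ⟨hF.1.sub hG.1, fun x hx => ?_⟩
  rw [intervalIntegral.integral_sub (intervalIntegrable_of_mem hF.1 hx)
    (intervalIntegrable_of_mem hG.1 hx)]
  linarith [hF.2 x hx, hG.2 x hx]

lemma add (hF : IsPrimitive F f) (hG : IsPrimitive G g) :
    IsPrimitive (fun x => F x + G x) (fun x => f x + g x) := by
  refine ⟨hF.1.add hG.1, fun x hx => ?_⟩
  rw [intervalIntegral.integral_add (intervalIntegrable_of_mem hF.1 hx)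
    (intervalIntegrable_of_mem hG.1 hx)]
  linarith [hF.2 x hx, hG.2 x hx]

/-- The product rule for absolutely continuous functions. -/
lemma mul (hF : IsPrimitive F f) (hG : IsPrimitive G g) :
    IsPrimitive (fun x => F x * G x) (fun x => f x * G x + F x * g x) := by
  have hFc := hF.continuousOn
  have hGc := hG.continuousOn
  rw [← uIcc_of_le pi_pos.le] at hFc hGc
  refine ⟨(hF.1.mul_continuousOn hGc).add (hG.1.continuousOn_mul hFc), fun x hx => ?_⟩
  have key : ∀ {H h : ℝ → ℝ}, IsPrimitive H h →
      AbsolutelyContinuousOnInterval (fun x => H 0 + ∫ t in (0:ℝ)..x, h t) 0 x ∧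
      ∀ᵐ y, y ∈ uIcc 0 x → deriv (fun x => H 0 + ∫ t in (0:ℝ)..x, h t) y = h y := by
    intro H h hH
    have hi := intervalIntegrable_of_mem hH.1 hx
    refine ⟨AbsolutelyContinuousOnInterval.add (f := fun _ => H 0)
      (LipschitzWith.const (H 0)).lipschitzOnWith.absolutelyContinuousOnInterval
      (hi.absolutelyContinuousOnInterval_intervalIntegral left_mem_uIcc), ?_⟩
    filter_upwards [hi.ae_hasDerivAt_integral] with y hy hyx
    exact ((hy hyx 0 left_mem_uIcc).const_add _).deriv
  obtain ⟨aF, dF⟩ := key hF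
  obtain ⟨aG, dG⟩ := key hG
  have := aF.integral_deriv_mul_eq_sub aG
  rw [← hF.2 x hx, ← hG.2 x hx] at this
  simp only [intervalIntegral.integral_same, add_zero] at this
  rw [← sub_eq_iff_eq_add', ← this]
  apply intervalIntegral.integral_congr_ae
  filter_upwards [dF, dG] with y h1 h2 hy
  have hy' := uIoc_subset_uIcc hy
  rw [h1 hy', h2 hy']
  rw [uIcc_of_le hx.1] at hy'
  rw [← hF.2 y ⟨hy'.1, hy'.2.trans hx.2⟩, ← hG.2 y ⟨hy'.1, hy'.2.trans hx.2⟩]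

end IsPrimitive

lemma SLSol.isPrimitive {q : ℝ → ℝ} {μ : ℝ} {y y' : ℝ → ℝ} (h : SLSol q μ y y') :
    IsPrimitive y y' :=
  ⟨intervalIntegrable_of_continuousOn h.2.1, h.2.2.1⟩

lemma SLSol.isPrimitive' {q : ℝ → ℝ} (hq : IntervalIntegrable q volume 0 π) {μ : ℝ}
    {y y' : ℝ → ℝ} (h : SLSol q μ y y') : IsPrimitive y' (fun t => (q t - μ) * y t) :=
  ⟨(hq.sub intervalIntegrable_const).mul_continuousOn (by rw [uIcc_of_le pi_pos.le]; exact h.1),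
    h.2.2.2⟩

/-- The Wronskian identity for solutions at two spectral parameters. -/
lemma SLSol.wronskian {q : ℝ → ℝ} (hq : IntervalIntegrable q volume 0 π) {μ ν : ℝ}
    {u u' v v' : ℝ → ℝ} (hu : SLSol q μ u u') (hv : SLSol q ν v v') {x : ℝ}
    (hx : x ∈ Icc (0:ℝ) π) :
    u x * v' x - u' x * v x =
      u 0 * v' 0 - u' 0 * v 0 + (μ - ν) * ∫ t in (0:ℝ)..x, u t * v t := by
  have h := (hu.isPrimitive.mul (hv.isPrimitive' hq)).sub
    ((hu.isPrimitive' hq).mul hv.isPrimitive)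
  rw [← intervalIntegral.integral_const_mul]
  refine (h.congr_deriv (g := fun t => (μ - ν) * (u t * v t)) fun t => ?_).2 x hx
  ring

/-- The energy identity for a solution. -/
lemma SLSol.energy {q : ℝ → ℝ} (hq : IntervalIntegrable q volume 0 π) {μ : ℝ}
    {y y' : ℝ → ℝ} (h : SLSol q μ y y') :
    y π * y' π = y 0 * y' 0 + ∫ t in (0:ℝ)..π, (y' t * y' t + y t * ((q t - μ) * y t)) :=
  (h.isPrimitive.mul (h.isPrimitive' hq)).2 π ⟨pi_pos.le, le_rfl⟩

lemma abs_clamp_sub_clamp_le {R : ℝ} (a b : ℝ) :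
    |max (-R) (min R a) - max (-R) (min R b)| ≤ |a - b| := by
  calc _ ≤ |min R a - min R b| := by
        simpa [max_comm (-R)] using abs_max_sub_max_le_abs (min R a) (min R b) (-R)
    _ ≤ |a - b| := by
        rw [min_comm R, min_comm R]
        exact (abs_inf_sub_inf_le_abs a b R)

lemma abs_clamp_le {R : ℝ} (hR : 0 ≤ R) (a : ℝ) : |max (-R) (min R a)| ≤ R :=
  abs_le.2 ⟨le_max_left _ _, max_le (by linarith) (min_le_left _ _)⟩

/-- Solutions of the first-order system `y' = Q y + u`, `u' = -Q² y - Q u` with continuous `Q`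
exist on `[0, π]` for all initial data. -/
lemma exists_quasiDerivative_system {Q : ℝ → ℝ} (hQ : ContinuousOn Q (Icc 0 π)) (a b : ℝ) :
    ∃ z : ℝ → ℝ × ℝ, z 0 = (a, b) ∧ ∀ t ∈ Icc (0:ℝ) π,
      HasDerivWithinAt z (Q t * (z t).1 + (z t).2, -(Q t ^ 2 * (z t).1 + Q t * (z t).2))
        (Icc 0 π) t := by
  obtain ⟨B, hB⟩ := isCompact_Icc.exists_bound_of_continuousOn hQ
  have hB0 : 0 ≤ B := (norm_nonneg _).trans (hB 0 ⟨le_rfl, pi_pos.le⟩)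
  obtain ⟨K, hK⟩ : ∃ K : NNReal, (K : ℝ) = (1 + B) ^ 2 := ⟨⟨(1 + B) ^ 2, by positivity⟩, rfl⟩
  have lin : ∀ t ∈ Icc (0:ℝ) π, ∀ p s m : ℝ, |p| ≤ m → |s| ≤ m →
      |Q t * p + s| ≤ K * m ∧ |-(Q t ^ 2 * p + Q t * s)| ≤ K * m := by
    intro t ht p s m hp hs
    have hQt : |Q t| ≤ B := hB t ht
    have hm : 0 ≤ m := (abs_nonneg _).trans hp
    have h1 : |Q t * p| ≤ B * m := by rw [abs_mul]; gcongr
    have h2 : |Q t * s| ≤ B * m := by rw [abs_mul]; gcongr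
    have h3 : |Q t ^ 2 * p| ≤ B ^ 2 * m := by rw [abs_mul, abs_pow]; gcongr
    have h4 : 0 ≤ B * m := by positivity
    have h5 : 0 ≤ B ^ 2 * m := by positivity
    rw [hK]
    constructor
    · refine (abs_add_le _ _).trans ?_
      nlinarith
    · rw [abs_neg]
      refine (abs_add_le _ _).trans ?_
      nlinarith
  obtain ⟨R, hR⟩ : ∃ R : NNReal, (R : ℝ) = ‖((a, b) : ℝ × ℝ)‖ * exp (K * π) :=
    ⟨⟨‖((a, b) : ℝ × ℝ)‖ * exp (K * π), by positivity⟩, rfl⟩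
  obtain ⟨P, hP⟩ : ∃ P : NNReal, (P : ℝ) = π := ⟨⟨π, pi_pos.le⟩, rfl⟩
  let c : ℝ → ℝ := fun w => max (-R) (min R w)
  let f : ℝ → ℝ × ℝ → ℝ × ℝ := fun t x =>
    (Q t * c x.1 + c x.2, -(Q t ^ 2 * c x.1 + Q t * c x.2))
  have hpl : IsPicardLindelof f (tmin := 0) (tmax := π) ⟨0, le_rfl, pi_pos.le⟩ (a, b)
      (K * R * P) 0 (K * R) K := by
    refine ⟨fun t ht => LipschitzOnWith.of_dist_le_mul fun x _ y _ => ?_, fun x _ => ?_,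
      fun t ht x _ => ?_, ?_⟩
    · have h1 : |x.1 - y.1| ≤ dist x y := by
        rw [← Real.dist_eq, Prod.dist_eq]; exact le_max_left _ _
      have h2 : |x.2 - y.2| ≤ dist x y := by
        rw [← Real.dist_eq, Prod.dist_eq]; exact le_max_right _ _
      obtain ⟨h3, h4⟩ := lin t ht (c x.1 - c y.1) (c x.2 - c y.2) (dist x y)
        ((abs_clamp_sub_clamp_le _ _).trans h1) ((abs_clamp_sub_clamp_le _ _).trans h2)
      rw [Prod.dist_eq (x := f t x), Real.dist_eq, Real.dist_eq]
      refine max_le ?_ ?_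
      · rwa [show (f t x).1 - (f t y).1 = Q t * (c x.1 - c y.1) + (c x.2 - c y.2) by
          simp only [f]; ring]
      · rwa [show (f t x).2 - (f t y).2 =
          -(Q t ^ 2 * (c x.1 - c y.1) + Q t * (c x.2 - c y.2)) by simp only [f]; ring]
    · exact ((hQ.mul continuousOn_const).add continuousOn_const).prodMk
        (((hQ.pow 2).mul continuousOn_const).add (hQ.mul continuousOn_const)).neg
    · obtain ⟨h3, h4⟩ := lin t ht (c x.1) (c x.2) R (abs_clamp_le R.2 _) (abs_clamp_le R.2 _)
      rw [Prod.norm_def]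
      exact max_le h3 h4
    · simp [pi_pos.le, hP]
  obtain ⟨z, hz0, hz⟩ := hpl.exists_eq_forall_mem_Icc_hasDerivWithinAt₀
  have hz0 : z 0 = (a, b) := hz0
  refine ⟨z, hz0, fun t ht => ?_⟩
  have hbound : ∀ x ∈ Icc (0:ℝ) π, ‖z x‖ ≤ gronwallBound ‖((a, b) : ℝ × ℝ)‖ K 0 (x - 0) := by
    refine norm_le_gronwallBound_of_norm_deriv_right_le (f' := fun t => f t (z t))
      (fun t ht => (hz t ht).continuousWithinAt) (fun t ht => ?_) (by rw [hz0]) (fun t ht => ?_)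
    · exact (hz t ⟨ht.1, ht.2.le⟩).mono_of_mem_nhdsWithin (Icc_mem_nhdsGE_of_mem ht)
    · have hc : ∀ w : ℝ, |c w| ≤ |w| := fun w => by
        simpa [c, abs_le, R.2] using abs_clamp_sub_clamp_le (R := R) w 0
      obtain ⟨h3, h4⟩ := lin t ⟨ht.1, ht.2.le⟩ (c (z t).1) (c (z t).2) ‖z t‖
        ((hc _).trans (norm_fst_le (z t))) ((hc _).trans (norm_snd_le (z t)))
      rw [add_zero, Prod.norm_def]
      exact max_le h3 h4
  have hzR : ‖z t‖ ≤ R := by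
    refine (hbound t ht).trans ?_
    rw [gronwallBound_ε0, hR, sub_zero]
    gcongr
    exact ht.2
  have hcl : ∀ w : ℝ, |w| ≤ R → c w = w := fun w hw => by
    simp only [c]
    rw [min_eq_right (abs_le.1 hw).2, max_eq_right (abs_le.1 hw).1]
  have := hz t ht
  simp only [f, hcl _ ((norm_fst_le (z t)).trans hzR), hcl _ ((norm_snd_le (z t)).trans hzR)]
    at this
  exact this

/-- Existence of solutions with prescribed initial data. -/
lemma exists_SLSol {q : ℝ → ℝ} (hq : IntervalIntegrable q volume 0 π) (μ a b : ℝ) :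
    ∃ y y', SLSol q μ y y' ∧ y 0 = a ∧ y' 0 = b := by
  have hr : IntervalIntegrable (fun t => q t - μ) volume 0 π := hq.sub intervalIntegrable_const
  let Q : ℝ → ℝ := fun x => ∫ t in (0:ℝ)..x, (q t - μ)
  have hQ0 : Q 0 = 0 := intervalIntegral.integral_same
  have hQ : IsPrimitive Q (fun t => q t - μ) := ⟨hr, fun x _ => by rw [hQ0, zero_add]⟩
  obtain ⟨z, hz0, hz⟩ := exists_quasiDerivative_system hQ.continuousOn a b
  have hzc : ContinuousOn z (Icc 0 π) := fun t ht => (hz t ht).continuousWithinAt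
  have prim : ∀ {F f : ℝ → ℝ}, ContinuousOn f (Icc 0 π) →
      (∀ t ∈ Icc (0:ℝ) π, HasDerivWithinAt F (f t) (Icc 0 π) t) → IsPrimitive F f := by
    intro F f hf hF
    have hi := intervalIntegrable_of_continuousOn hf
    refine ⟨hi, fun x hx => ?_⟩
    rw [intervalIntegral.integral_eq_sub_of_hasDerivAt_of_le hx.1
      (fun t ht => (hF t ⟨ht.1, ht.2.trans hx.2⟩).continuousWithinAt.mono
        (Icc_subset_Icc_right hx.2))
      (fun t ht => (hF t ⟨ht.1.le, ht.2.le.trans hx.2⟩).hasDerivAt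
        (Icc_mem_nhds ht.1 (ht.2.trans_le hx.2)))
      (IsPrimitive.intervalIntegrable_of_mem hi hx)]
    ring
  have hQc := hQ.continuousOn
  have h1 : IsPrimitive (fun t => (z t).1) (fun t => Q t * (z t).1 + (z t).2) :=
    prim (by fun_prop) fun t ht =>
      (ContinuousLinearMap.fst ℝ ℝ ℝ).hasFDerivAt.comp_hasDerivWithinAt t (hz t ht)
  have h2 : IsPrimitive (fun t => (z t).2) (fun t => -(Q t ^ 2 * (z t).1 + Q t * (z t).2)) :=
    prim (by fun_prop) fun t ht =>
      (ContinuousLinearMap.snd ℝ ℝ ℝ).hasFDerivAt.comp_hasDerivWithinAt t (hz t ht)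
  have h3 := ((hQ.mul h1).add h2).congr_deriv (g := fun t => (q t - μ) * (z t).1) fun t => by ring
  exact ⟨fun t => (z t).1, fun t => Q t * (z t).1 + (z t).2,
    ⟨h1.continuousOn, by fun_prop, h1.2, h3.2⟩, by simp [hz0], by simp [hz0, hQ0]⟩

/-- A fundamental system normalized to have Wronskian one. -/
lemma exists_fundamental_system {q : ℝ → ℝ} (hq : IntervalIntegrable q volume 0 π) (μ : ℝ) :
    ∃ c c' s s', SLSol q μ c c' ∧ SLSol q μ s s' ∧
      ∀ x ∈ Icc (0:ℝ) π, c x * s' x - c' x * s x = 1 := by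
  obtain ⟨c, c', hc, hc0, hc0'⟩ := exists_SLSol hq μ 1 0
  obtain ⟨s, s', hs, hs0, hs0'⟩ := exists_SLSol hq μ 0 1
  refine ⟨c, c', s, s', hc, hs, fun x hx => ?_⟩
  rw [hc.wronskian hq hs hx, hc0, hc0', hs0, hs0']
  ring

/-- The Wronskian of two solutions of the same equation is constant. -/
lemma SLSol.wronskian_eq_s14 {q : ℝ → ℝ} (hq : IntervalIntegrable q volume 0 π) {μ : ℝ}
    {u u' v v' : ℝ → ℝ} (hu : SLSol q μ u u') (hv : SLSol q μ v v') {x z : ℝ}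
    (hx : x ∈ Icc (0:ℝ) π) (hz : z ∈ Icc (0:ℝ) π) :
    u x * v' x - u' x * v x = u z * v' z - u' z * v z := by
  rw [hu.wronskian hq hv hx, hu.wronskian hq hv hz, sub_self, zero_mul, zero_mul]

/-- A solution whose Cauchy data vanish at a point is trivial. -/
lemma SLSol.eq_zero {q : ℝ → ℝ} (hq : IntervalIntegrable q volume 0 π) {μ : ℝ}
    {y y' : ℝ → ℝ} (h : SLSol q μ y y') {z : ℝ} (hz : z ∈ Icc (0:ℝ) π) (h0 : y z = 0)
    (h0' : y' z = 0) {x : ℝ} (hx : x ∈ Icc (0:ℝ) π) : y x = 0 ∧ y' x = 0 := by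
  obtain ⟨c, c', s, s', hc, hs, hw⟩ := exists_fundamental_system hq μ
  have h1 := h.wronskian_eq_s14 hq hc hx hz
  have h2 := h.wronskian_eq_s14 hq hs hx hz
  have h3 := hw x hx
  rw [h0, h0'] at h1 h2
  constructor
  · linear_combination (-y x) * h3 + c x * h2 - s x * h1
  · linear_combination (-y' x) * h3 + c' x * h2 - s' x * h1

/-- A solution vanishing identically has vanishing derivative. -/
lemma SLSol.deriv_eq_zero {q : ℝ → ℝ} (hq : IntervalIntegrable q volume 0 π) {μ : ℝ}
    {y y' : ℝ → ℝ} (h : SLSol q μ y y') (h0 : ∀ x ∈ Icc (0:ℝ) π, y x = 0) {x : ℝ}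
    (hx : x ∈ Icc (0:ℝ) π) : y' x = 0 := by
  have hπ : π ∈ Icc (0:ℝ) π := ⟨pi_pos.le, le_rfl⟩
  have hz : (0:ℝ) ∈ Icc (0:ℝ) π := ⟨le_rfl, pi_pos.le⟩
  by_contra hne
  have he := h.energy hq
  rw [h0 π hπ, h0 0 hz, zero_mul, zero_mul, zero_add,
    intervalIntegral.integral_congr (g := fun t => y' t * y' t) (fun t ht => by
      rw [uIcc_of_le pi_pos.le] at ht
      simp [h0 t ht])] at he
  exact he.not_lt (intervalIntegral.integral_pos pi_pos (h.2.1.mul h.2.1)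
    (fun t _ => mul_self_nonneg _) ⟨x, hx, mul_self_pos.2 hne⟩)

/-- Solutions with fixed initial data are locally Lipschitz in the spectral parameter. -/
lemma SLSol.exists_dist_le {q : ℝ → ℝ} (hq : IntervalIntegrable q volume 0 π)
    {φ φ' : ℝ → ℝ → ℝ} (hφ : ∀ μ, SLSol q μ (φ μ) (φ' μ)) {a b : ℝ} (h0 : ∀ μ, φ μ 0 = a)
    (h0' : ∀ μ, φ' μ 0 = b) (ν : ℝ) :
    ∃ C ε : ℝ, 0 < ε ∧ 0 ≤ C ∧ ∀ μ, |μ - ν| < ε → ∀ x ∈ Icc (0:ℝ) π,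
      |φ μ x - φ ν x| ≤ C * |μ - ν| ∧ |φ' μ x - φ' ν x| ≤ C * |μ - ν| := by
  obtain ⟨c, c', s, s', hc, hs, hw⟩ := exists_fundamental_system hq ν
  have hz : (0:ℝ) ∈ Icc (0:ℝ) π := ⟨le_rfl, pi_pos.le⟩
  obtain ⟨U, hU⟩ := isCompact_Icc.exists_bound_of_continuousOn (hφ ν).1
  obtain ⟨K, hK⟩ := isCompact_Icc.exists_bound_of_continuousOn
    ((hc.1.norm.add hc.2.1.norm).add (hs.1.norm.add hs.2.1.norm))
  simp only [Real.norm_eq_abs] at hU hK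
  have hK' : ∀ x ∈ Icc (0:ℝ) π, |c x| ≤ K ∧ |c' x| ≤ K ∧ |s x| ≤ K ∧ |s' x| ≤ K := by
    intro x hx
    have : |c x| + |c' x| + (|s x| + |s' x|) ≤ K := (le_abs_self _).trans (hK x hx)
    have := abs_nonneg (c x); have := abs_nonneg (c' x)
    have := abs_nonneg (s x); have := abs_nonneg (s' x)
    refine ⟨?_, ?_, ?_, ?_⟩ <;> linarith
  have hK0 : 0 ≤ K := (abs_nonneg _).trans (hK 0 hz)
  have hU0 : 0 ≤ U := (abs_nonneg _).trans (hU 0 hz)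
  have hπ := pi_pos
  refine ⟨4 * π * K ^ 2 * U, 1 / (4 * π * K ^ 2 + 1), by positivity, by positivity,
    fun μ hμ => ?_⟩
  obtain ⟨z, hzI, hzmax⟩ := isCompact_Icc.exists_isMaxOn ⟨0, hz⟩ (hφ μ).1.norm
  set S := |φ μ z| with hS
  have hSle : ∀ x ∈ Icc (0:ℝ) π, |φ μ x| ≤ S := fun x hx => hzmax hx
  have hS0 : 0 ≤ S := abs_nonneg _
  have hint : ∀ w : ℝ → ℝ, (∀ x ∈ Icc (0:ℝ) π, |w x| ≤ K) → ∀ x ∈ Icc (0:ℝ) π,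
      |∫ t in (0:ℝ)..x, φ μ t * w t| ≤ S * K * π := by
    intro w hw x hx
    rw [← Real.norm_eq_abs]
    refine (intervalIntegral.norm_integral_le_of_norm_le_const (C := S * K) fun t ht => ?_).trans ?_
    · rw [uIoc_of_le hx.1] at ht
      have ht' : t ∈ Icc (0:ℝ) π := ⟨ht.1.le, ht.2.trans hx.2⟩
      rw [Real.norm_eq_abs, abs_mul]
      have := hSle t ht'
      have := hw t ht'
      gcongr
    · rw [sub_zero, abs_of_nonneg hx.1]
      gcongr
      exact hx.2
  have hdiff : ∀ x ∈ Icc (0:ℝ) π, |φ μ x - φ ν x| ≤ |μ - ν| * (2 * K * (S * K * π)) ∧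
      |φ' μ x - φ' ν x| ≤ |μ - ν| * (2 * K * (S * K * π)) := by
    intro x hx
    have e1 := (hφ μ).wronskian hq hc hx
    have e2 := (hφ μ).wronskian hq hs hx
    have e3 := (hφ ν).wronskian hq hc hx
    have e4 := (hφ ν).wronskian hq hs hx
    rw [sub_self, zero_mul, add_zero] at e3 e4
    rw [h0, h0'] at e1 e2 e3 e4
    have hwx := hw x hx
    have i1 := hint c (fun x hx => (hK' x hx).1) x hx
    have i2 := hint s (fun x hx => (hK' x hx).2.2.1) x hx
    set I₁ := ∫ t in (0:ℝ)..x, φ μ t * c t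
    set I₂ := ∫ t in (0:ℝ)..x, φ μ t * s t
    have comb : ∀ p r : ℝ, |p| ≤ K → |r| ≤ K →
        |(μ - ν) * (p * I₂ - r * I₁)| ≤ |μ - ν| * (2 * K * (S * K * π)) := by
      intro p r hp hr
      rw [abs_mul]
      gcongr
      calc |p * I₂ - r * I₁| ≤ |p * I₂| + |r * I₁| := abs_sub _ _
        _ ≤ K * (S * K * π) + K * (S * K * π) := by rw [abs_mul, abs_mul]; gcongr
        _ = _ := by ring
    obtain ⟨k1, k2, k3, k4⟩ := hK' x hx
    constructor
    · rw [show φ μ x - φ ν x = (μ - ν) * (c x * I₂ - s x * I₁) by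
        linear_combination (-(φ μ x - φ ν x)) * hwx + c x * (e2 - e4) - s x * (e1 - e3)]
      exact comb _ _ k1 k3
    · rw [show φ' μ x - φ' ν x = (μ - ν) * (c' x * I₂ - s' x * I₁) by
        linear_combination (-(φ' μ x - φ' ν x)) * hwx + c' x * (e2 - e4) - s' x * (e1 - e3)]
      exact comb _ _ k2 k4
  have hS2 : S ≤ 2 * U := by
    have h1 := (hdiff z hzI).1
    have h2 := hU z hzI
    have h3 : S ≤ |φ μ z - φ ν z| + |φ ν z| := by
      have := abs_add_le (φ μ z - φ ν z) (φ ν z)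
      rwa [sub_add_cancel] at this
    have h4 : |μ - ν| * (4 * π * K ^ 2) ≤ 1 := by
      rw [lt_div_iff₀ (by positivity)] at hμ
      nlinarith [abs_nonneg (μ - ν)]
    nlinarith
  intro x hx
  have : |μ - ν| * (2 * K * (S * K * π)) ≤ 4 * π * K ^ 2 * U * |μ - ν| := by
    calc _ ≤ |μ - ν| * (2 * K * (2 * U * K * π)) := by gcongr
      _ = _ := by ring
  exact ⟨(hdiff x hx).1.trans this, (hdiff x hx).2.trans this⟩

lemma IsPrimitive.abs_sub_le {F f : ℝ → ℝ} (hF : IsPrimitive F f) {x z : ℝ}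
    (hx : x ∈ Icc (0:ℝ) π) (hz : z ∈ Icc (0:ℝ) π) : |F x - F z| ≤ ∫ t in (0:ℝ)..π, |f t| := by
  rw [hF.2 x hx, hF.2 z hz, add_sub_add_left_eq_sub, intervalIntegral.integral_interval_sub_left
    (intervalIntegrable_of_mem hF.1 hx) (intervalIntegrable_of_mem hF.1 hz),
    intervalIntegral.integral_of_le pi_pos.le]
  refine intervalIntegral.norm_integral_le_integral_norm_uIoc.trans
    (setIntegral_mono_set hF.1.1.norm (.of_forall fun _ => norm_nonneg _)
      (LE.le.eventuallyLE ?_))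
  intro t ht
  exact ⟨(le_min hz.1 hx.1).trans_lt ht.1, ht.2.trans (max_le hz.2 hx.2)⟩

/-- Eigenvalues are bounded below, uniformly over boundary conditions with bounded boundary
form. -/
lemma SLSol.exists_lower_bound {q : ℝ → ℝ} (hq : IntervalIntegrable q volume 0 π) {C : ℝ}
    (hC : 0 ≤ C) : ∃ m, ∀ μ y y', SLSol q μ y y' → y π * y' π ≤ C * y π ^ 2 →
      -(y 0 * y' 0) ≤ C * y 0 ^ 2 → (∃ x ∈ Icc (0:ℝ) π, y x ≠ 0) → m ≤ μ := by
  have hπ := pi_pos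
  have hz : (0:ℝ) ∈ Icc (0:ℝ) π := ⟨le_rfl, pi_pos.le⟩
  have hπ' : π ∈ Icc (0:ℝ) π := ⟨pi_pos.le, le_rfl⟩
  set A := ∫ t in (0:ℝ)..π, |q t|
  have hA : 0 ≤ A := intervalIntegral.integral_nonneg hπ.le fun _ _ => abs_nonneg _
  set K := 2 * C + A + 1
  have hK : 0 < K := by positivity
  refine ⟨-(K * (1 / π + K)), fun μ y y' h hR hL ⟨w, hw, hwne⟩ => ?_⟩
  obtain ⟨z, hzI, hzmax⟩ := isCompact_Icc.exists_isMaxOn ⟨0, hz⟩ (h.1.pow 2)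
  set S := y z ^ 2
  have hSle : ∀ x ∈ Icc (0:ℝ) π, y x ^ 2 ≤ S := fun x hx => hzmax hx
  have hyi : IntervalIntegrable (fun t => y t ^ 2) volume 0 π :=
    intervalIntegrable_of_continuousOn (h.1.pow 2)
  have hyi' : IntervalIntegrable (fun t => y' t ^ 2) volume 0 π :=
    intervalIntegrable_of_continuousOn (h.2.1.pow 2)
  have hqy : IntervalIntegrable (fun t => q t * y t ^ 2) volume 0 π :=
    hq.mul_continuousOn (by rw [uIcc_of_le hπ.le]; exact h.1.pow 2)
  set N := ∫ t in (0:ℝ)..π, y t ^ 2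
  set D := ∫ t in (0:ℝ)..π, y' t ^ 2
  have hN : 0 < N := intervalIntegral.integral_pos hπ (h.1.pow 2) (fun _ _ => sq_nonneg _)
    ⟨w, hw, by positivity⟩
  have henergy : y π * y' π = y 0 * y' 0 + (D + (∫ t in (0:ℝ)..π, q t * y t ^ 2) - μ * N) := by
    rw [h.energy hq, ← intervalIntegral.integral_const_mul,
      ← intervalIntegral.integral_add hyi' hqy,
      ← intervalIntegral.integral_sub (hyi'.add hqy) (hyi.const_mul μ)]
    congr 1
    exact intervalIntegral.integral_congr fun t _ => by ring
  have hpot : -(A * S) ≤ ∫ t in (0:ℝ)..π, q t * y t ^ 2 := by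
    rw [← intervalIntegral.integral_mul_const, ← intervalIntegral.integral_neg]
    refine intervalIntegral.integral_mono_on hπ.le (hq.abs.mul_const S).neg hqy fun t ht => ?_
    have h1 := hSle t ht
    have h2 := neg_abs_le (q t)
    have h3 : |q t| * y t ^ 2 ≤ |q t| * S := by gcongr
    nlinarith [sq_nonneg (y t)]
  have hDN : D - μ * N ≤ K * S := by
    have h1 := hSle π hπ'
    have h2 := hSle 0 hz
    have h3 : C * y π ^ 2 ≤ C * S := by gcongr
    have h4 : C * y 0 ^ 2 ≤ C * S := by gcongr
    have h5 : 0 ≤ S := sq_nonneg _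
    simp only [K]
    nlinarith
  have hJ : ∀ t ∈ Icc (0:ℝ) π, S ≤ y t ^ 2 + (D / K + K * N) := by
    intro t ht
    have hp := h.isPrimitive.mul h.isPrimitive
    have h1 := (le_abs_self _).trans (hp.abs_sub_le hzI ht)
    have h2 : ∫ t in (0:ℝ)..π, |y' t * y t + y t * y' t| ≤ D / K + K * N := by
      rw [← intervalIntegral.integral_div, ← intervalIntegral.integral_const_mul,
        ← intervalIntegral.integral_add (hyi'.div_const K) (hyi.const_mul K)]
      refine intervalIntegral.integral_mono_on hπ.le hp.1.abs
        ((hyi'.div_const K).add (hyi.const_mul K)) fun t _ => ?_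
      have e : ∀ σ : ℝ, y' t ^ 2 / K + K * y t ^ 2 - σ * (2 * (y' t * y t)) =
          (y' t - σ * K * y t) ^ 2 / K + (1 - σ ^ 2) * K * y t ^ 2 := by
        intro σ; field_simp; ring
      have e1 := e 1
      have e2 := e (-1)
      have p1 : 0 ≤ (y' t - 1 * K * y t) ^ 2 / K := by positivity
      have p2 : 0 ≤ (y' t - -1 * K * y t) ^ 2 / K := by positivity
      rw [abs_le]
      constructor <;> nlinarith
    simp only [S, sq] at h1 h2 ⊢
    linarith
  have hS : π * S ≤ N + π * (D / K + K * N) := by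
    have := intervalIntegral.integral_mono_on hπ.le intervalIntegrable_const
      (hyi.add intervalIntegrable_const) hJ
    rw [intervalIntegral.integral_add hyi intervalIntegrable_const] at this
    simp only [intervalIntegral.integral_const, smul_eq_mul, sub_zero] at this
    exact this
  have hS' : K * S ≤ K * (1 / π + K) * N + D := by
    have := mul_le_mul_of_nonneg_left hS (by positivity : 0 ≤ K / π)
    calc K * S = K / π * (π * S) := by field_simp
      _ ≤ _ := this
      _ = _ := by field_simp; ring
  by_contra! hlt
  nlinarith

/-- A continuous function that increases just to the right of each point is increasing. -/
lemma strictMono_of_forall_exists_lt {θ : ℝ → ℝ} (hθ : Continuous θ)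
    (h : ∀ a, ∃ ε > 0, ∀ b, a < b → b < a + ε → θ a < θ b) : StrictMono θ := by
  have key : ∀ a b, a ≤ b → θ a ≤ θ b := by
    intro a b hab
    have hcl : IsClosed ({x | θ a ≤ θ x} ∩ Icc a b) :=
      (isClosed_le continuous_const hθ).inter isClosed_Icc
    refine hcl.Icc_subset_of_forall_exists_gt (le_refl (θ a)) ?_ ⟨hab, le_rfl⟩
    rintro x ⟨hx, -⟩ y hy
    obtain ⟨ε, hε, hx'⟩ := h x
    have h1 : x < min y (x + ε / 2) := lt_min hy (by linarith)
    have h2 : min y (x + ε / 2) < x + ε := (min_le_right _ _).trans_lt (by linarith)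
    exact ⟨_, (le_trans hx (hx' _ h1 h2).le : θ a ≤ _), h1, min_le_left _ _⟩
  intro a b hab
  obtain ⟨ε, hε, ha⟩ := h a
  have h1 : a < min b (a + ε / 2) := lt_min hab (by linarith)
  have h2 : min b (a + ε / 2) < a + ε := (min_le_right _ _).trans_lt (by linarith)
  exact (ha _ h1 h2).trans_le (key _ _ (min_le_left _ _))

/-- Continuous polar coordinates along a nonvanishing curve in the plane. -/
lemma exists_continuous_polar {u v : ℝ → ℝ} (hu : Continuous u) (hv : Continuous v)
    (h : ∀ t, u t = 0 → v t ≠ 0) :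
    ∃ r θ : ℝ → ℝ, Continuous θ ∧ ∀ t, 0 < r t ∧ u t = r t * cos (θ t) ∧
      v t = r t * sin (θ t) := by
  let f : C(ℝ, ℂ) := ⟨fun t => ⟨u t, v t⟩, by
    have : (fun t => (⟨u t, v t⟩ : ℂ)) = fun t => (u t : ℂ) + v t * Complex.I := by
      ext t; exact Complex.mk_eq_add_mul_I _ _
    rw [this]; fun_prop⟩
  have hne : ∀ t, f t ≠ 0 := fun t ht =>
    h t (congrArg Complex.re ht) (congrArg Complex.im ht)
  obtain ⟨F, ⟨-, hF⟩, -⟩ := Complex.isCoveringMapOn_exp.existsUnique_continuousMap_lifts f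
    (Complex.exp_log (hne 0)) fun t => hne t
  refine ⟨fun t => exp (F t).re, fun t => (F t).im, by fun_prop, fun t => ?_⟩
  have ht : Complex.exp (F t) = ⟨u t, v t⟩ := congrFun hF t
  refine ⟨exp_pos _, ?_, ?_⟩
  · rw [← Complex.exp_re, ht]
  · rw [← Complex.exp_im, ht]

/-- Consecutive zeros of `sin (θ + β)` correspond to consecutive multiples of `π`. -/
lemma angle_eq_add_mul_pi {θ : ℝ → ℝ} (hθ : Continuous θ) (hmono : StrictMono θ) {β : ℝ}
    {z : ℕ → ℝ} (hz : StrictMono z) (h : ∀ μ, sin (θ μ + β) = 0 ↔ ∃ n, μ = z n) (n : ℕ) :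
    θ (z n) = θ (z 0) + n * π := by
  have hπ := pi_pos
  induction n with
  | zero => simp
  | succ n ih =>
    obtain ⟨i, hi⟩ := sin_eq_zero_iff.1 ((h _).2 ⟨n, rfl⟩)
    obtain ⟨j, hj⟩ := sin_eq_zero_iff.1 ((h _).2 ⟨n + 1, rfl⟩)
    have hlt := hmono (hz n.lt_succ_self)
    have hij : i + 1 ≤ j := by
      have : (i : ℝ) * π < j * π := by rw [hi, hj]; linarith
      exact_mod_cast lt_of_mul_lt_mul_right this hπ.le
    have hij' : ((i : ℝ) + 1) * π ≤ j * π := by gcongr; exact_mod_cast hij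
    have hmem : θ (z n) + π ∈ Icc (θ (z n)) (θ (z (n + 1))) := ⟨by linarith, by linarith⟩
    obtain ⟨μ, -, hμ⟩ := intermediate_value_Icc (hz n.lt_succ_self).le hθ.continuousOn hmem
    obtain ⟨k, rfl⟩ := (h μ).1 (by
      rw [hμ, add_right_comm, sin_add_pi, (h _).2 ⟨n, rfl⟩, neg_zero])
    have hnk : n + 1 ≤ k := hz.lt_iff_lt.1 (hmono.lt_iff_lt.1 (by linarith))
    have := hmono.monotone (hz.monotone hnk)
    rw [le_antisymm (by linarith : θ (z (n + 1)) ≤ θ (z n) + π) (by linarith), ih]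
    push_cast
    ring

/-- A limit of values of an increasing continuous function lifts to the arguments. -/
lemma tendsto_of_strictMono_comp {θ : ℝ → ℝ} (hmono : StrictMono θ) {ι : Type*}
    {l : Filter ι} {g : ι → ℝ} {a : ℝ} (h : Filter.Tendsto (fun i => θ (g i)) l (nhds (θ a))) :
    Filter.Tendsto g l (nhds a) := by
  refine tendsto_order.2 ⟨fun b hb => ?_, fun b hb => ?_⟩
  · filter_upwards [h.eventually_const_lt (hmono hb)] with i hi using hmono.lt_iff_lt.1 hi
  · filter_upwards [h.eventually_lt_const (hmono hb)] with i hi using hmono.lt_iff_lt.1 hi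

/-- The Prüfer angle at `π` of the solutions satisfying the boundary condition at `0`. -/
lemma exists_angle {q : ℝ → ℝ} (hq : IntervalIntegrable q volume 0 π) (α : ℝ) :
    ∃ θ : ℝ → ℝ, Continuous θ ∧ StrictMono θ ∧
      (∀ β μ, IsEigenvalue q α β μ ↔ sin (θ μ + β) = 0) ∧
      ∀ c > 0, ∀ m, ∃ μ < m, |sin (θ μ)| < c := by
  have hπ : π ∈ Icc (0:ℝ) π := ⟨pi_pos.le, le_rfl⟩
  have hz : (0:ℝ) ∈ Icc (0:ℝ) π := ⟨le_rfl, pi_pos.le⟩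
  choose φ φ' hφ h0 h0' using fun μ => exists_SLSol hq μ (sin α) (-cos α)
  have hne : ∀ μ x, x ∈ Icc (0:ℝ) π → φ' μ x = 0 → φ μ x ≠ 0 := by
    intro μ x hx h1 h2
    have := (hφ μ).eq_zero hq hx h2 h1 hz
    rw [h0, h0'] at this
    have h3 := sin_sq_add_cos_sq α
    rw [this.1, neg_eq_zero.1 this.2] at h3
    norm_num at h3
  have hnz : ∀ μ, ∃ x ∈ Icc (0:ℝ) π, φ μ x ≠ 0 := by
    intro μ
    by_contra! h
    exact hne μ 0 hz ((hφ μ).deriv_eq_zero hq h hz) (h 0 hz)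
  have hcont : ∀ ψ : ℝ → ℝ → ℝ, (∀ ν, ∃ C ε : ℝ, 0 < ε ∧ ∀ μ, |μ - ν| < ε →
      |ψ μ π - ψ ν π| ≤ C * |μ - ν|) → Continuous fun μ => ψ μ π := by
    intro ψ h
    refine continuous_iff_continuousAt.2 fun ν => ?_
    obtain ⟨C, ε, hε, hC⟩ := h ν
    refine tendsto_iff_norm_sub_tendsto_zero.2
      (squeeze_zero_norm' (a := fun μ => C * |μ - ν|) ?_ ?_)
    · filter_upwards [Metric.ball_mem_nhds ν hε] with μ hμ
      rw [norm_norm]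
      exact hC μ hμ
    · have : Continuous fun μ : ℝ => C * |μ - ν| := by fun_prop
      simpa using this.tendsto ν
  have hdist := SLSol.exists_dist_le hq hφ h0 h0'
  have hcφ : Continuous fun μ => φ μ π := hcont φ fun ν => by
    obtain ⟨C, ε, hε, -, hC⟩ := hdist ν
    exact ⟨C, ε, hε, fun μ hμ => (hC μ hμ π hπ).1⟩
  have hcφ' : Continuous fun μ => φ' μ π := hcont φ' fun ν => by
    obtain ⟨C, ε, hε, -, hC⟩ := hdist ν
    exact ⟨C, ε, hε, fun μ hμ => (hC μ hμ π hπ).2⟩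
  obtain ⟨r, θ, hθ, hrθ⟩ := exists_continuous_polar hcφ' hcφ fun μ => hne μ π hπ
  refine ⟨θ, hθ, strictMono_of_forall_exists_lt hθ fun ν => ?_, fun β μ => ?_, ?_⟩
  · have hpos : 0 < ∫ t in (0:ℝ)..π, φ ν t * φ ν t := by
      obtain ⟨x, hx, hxne⟩ := hnz ν
      exact intervalIntegral.integral_pos pi_pos ((hφ ν).1.mul (hφ ν).1)
        (fun t _ => mul_self_nonneg _) ⟨x, hx, mul_self_pos.2 hxne⟩
    obtain ⟨C, ε, hε, hC0, hC⟩ := hdist ν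
    obtain ⟨U, hU⟩ := isCompact_Icc.exists_bound_of_continuousOn (hφ ν).1
    have hU0 : 0 ≤ U := (norm_nonneg _).trans (hU 0 hz)
    obtain ⟨δ, hδ, hδθ⟩ := Metric.continuous_iff.1 hθ ν π pi_pos
    set I := ∫ t in (0:ℝ)..π, φ ν t * φ ν t
    set η := I / (π * C * U + 1)
    have hη : 0 < η := by positivity
    refine ⟨min ε (min δ η), by positivity, fun μ hlt hμ => ?_⟩
    have hd : 0 < μ - ν := sub_pos.2 hlt
    have hd' : |μ - ν| = μ - ν := abs_of_pos hd
    obtain ⟨h1, h2⟩ := lt_min_iff.1 (sub_lt_iff_lt_add'.2 hμ)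
    obtain ⟨h2, h3⟩ := lt_min_iff.1 h2
    have hint : |(∫ t in (0:ℝ)..π, φ μ t * φ ν t) - I| < I := by
      have hsub := intervalIntegral.integral_sub
        (intervalIntegrable_of_continuousOn ((hφ μ).1.mul (hφ ν).1))
        (intervalIntegrable_of_continuousOn ((hφ ν).1.mul (hφ ν).1))
      simp only [Pi.mul_apply] at hsub
      rw [← hsub, ← Real.norm_eq_abs]
      refine (intervalIntegral.norm_integral_le_of_norm_le_const
        (C := C * (μ - ν) * U) fun t ht => ?_).trans_lt ?_
      · rw [uIoc_of_le pi_pos.le] at ht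
        have ht' := Ioc_subset_Icc_self ht
        have e := (hC μ (hd'.trans_lt h1) t ht').1
        rw [hd'] at e
        rw [← sub_mul, norm_mul]
        exact mul_le_mul e (hU t ht') (norm_nonneg _) (by positivity)
      · rw [sub_zero, abs_of_pos pi_pos]
        rw [lt_div_iff₀ (by positivity)] at h3
        linarith
    have hIpos : 0 < ∫ t in (0:ℝ)..π, φ μ t * φ ν t := by
      linarith [(abs_lt.1 hint).1]
    have hw := (hφ μ).wronskian hq (hφ ν) hπ
    obtain ⟨r1, u1, v1⟩ := hrθ μ
    obtain ⟨r2, u2, v2⟩ := hrθ ν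
    rw [h0, h0, h0', h0', u1, u2, v1, v2] at hw
    have hs : 0 < sin (θ μ - θ ν) := by
      rw [sin_sub]
      refine (mul_pos_iff_of_pos_left (mul_pos r1 r2)).1 ?_
      have := mul_pos hd hIpos
      linarith
    have hlt := hδθ μ (by rwa [Real.dist_eq, hd'])
    rw [Real.dist_eq] at hlt
    by_contra! hle
    exact hs.not_ge
      (sin_nonpos_of_nonpos_of_neg_pi_le (by linarith) (by linarith [(abs_lt.1 hlt).1]))
  · obtain ⟨r0, u0, v0⟩ := hrθ μ
    rw [sin_add]
    constructor
    · rintro ⟨y, y', hy, ⟨x, hx, hxne⟩, hb0, hb⟩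
      have hw := (hφ μ).wronskian_eq_s14 hq hy hπ hz
      have hyπ : y π ≠ 0 ∨ y' π ≠ 0 := by
        by_contra! h
        exact hxne (hy.eq_zero hq hπ h.1 h.2 hx).1
      rw [h0, h0', u0, v0] at hw
      have hw' : sin (θ μ) * y' π - cos (θ μ) * y π = 0 := by
        refine (mul_eq_zero.1 ?_).resolve_left r0.ne'
        linear_combination hw + hb0
      rcases hyπ with h | h
      · refine (mul_eq_zero.1 ?_).resolve_left h
        linear_combination sin (θ μ) * hb - sin β * hw'
      · refine (mul_eq_zero.1 ?_).resolve_left h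
        linear_combination cos (θ μ) * hb + cos β * hw'
    · intro h
      refine ⟨φ μ, φ' μ, hφ μ, hnz μ, ?_, ?_⟩
      · rw [h0, h0']; ring
      · rw [u0, v0]
        linear_combination r μ * h
  · intro c hc m
    by_contra! h
    obtain ⟨l, hl⟩ := SLSol.exists_lower_bound hq (C := 1 / c + |cos α / sin α|) (by positivity)
    set μ := min m l - 1
    have hμm : μ < m := by linarith [min_le_left m l]
    have hμl : μ < l := by linarith [min_le_right m l]
    obtain ⟨r0, u0, v0⟩ := hrθ μ
    refine (hl μ _ _ (hφ μ) ?_ ?_ (hnz μ)).not_gt hμl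
    · have h1 : |cos (θ μ)| ≤ 1 / c * |sin (θ μ)| := by
        rw [one_div_mul_eq_div, le_div_iff₀ hc]
        exact (mul_le_of_le_one_left hc.le (abs_cos_le_one _)).trans (h μ hμm)
      have h2 : sin (θ μ) * cos (θ μ) ≤ (1 / c + |cos α / sin α|) * sin (θ μ) ^ 2 := by
        calc _ ≤ |sin (θ μ)| * |cos (θ μ)| := by rw [← abs_mul]; exact le_abs_self _
          _ ≤ |sin (θ μ)| * (1 / c * |sin (θ μ)|) := by gcongr
          _ = 1 / c * sin (θ μ) ^ 2 := by rw [← sq_abs]; ring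
          _ ≤ _ := by gcongr; exact le_add_of_nonneg_right (abs_nonneg _)
      rw [u0, v0]
      nlinarith [mul_le_mul_of_nonneg_left h2 (sq_nonneg (r μ))]
    · rw [h0, h0']
      rcases eq_or_ne (sin α) 0 with hs | hs
      · simp [hs]
      · calc _ = cos α / sin α * sin α ^ 2 := by field_simp
          _ ≤ _ := by
            gcongr
            exact (le_abs_self _).trans (le_add_of_nonneg_left (by positivity))

/-- An increasing continuous angle that comes close to multiples of `π` at arbitrarily negative
arguments and vanishes somewhere takes every value in `(-π, 0)`. -/
lemma exists_angle_eq_neg {θ : ℝ → ℝ} (hθ : Continuous θ) (hmono : StrictMono θ)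
    (hlow : ∀ c > 0, ∀ m, ∃ μ < m, |sin (θ μ)| < c) {a : ℝ} (ha : θ a = 0) {β : ℝ}
    (hβ : β ∈ Ioo (0:ℝ) π) : ∃ μ, θ μ = -β := by
  suffices h : ∃ μ, θ μ ≤ -β by
    obtain ⟨μ, hμ⟩ := h
    have hμa : μ ≤ a := hmono.le_iff_le.1 (by linarith [hβ.1])
    obtain ⟨x, -, hx⟩ := intermediate_value_Icc hμa hθ.continuousOn
      (⟨hμ, by linarith [hβ.1]⟩ : -β ∈ Icc (θ μ) (θ a))
    exact ⟨x, hx⟩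
  by_contra! h
  have h1 : θ (a - 1) < 0 := ha ▸ hmono (sub_one_lt a)
  have h2 := h (a - 1)
  have hmem : ∀ t, -β < t → t < 0 → -t ∈ Icc (0:ℝ) π := fun t ht ht' =>
    ⟨by linarith, by linarith [hβ.2]⟩
  obtain ⟨μ, hμ, hsin⟩ := hlow (min (sin β) (sin (-θ (a - 1))))
    (lt_min (sin_pos_of_pos_of_lt_pi hβ.1 hβ.2)
      (sin_pos_of_pos_of_lt_pi (by linarith) (by linarith [hβ.2]))) (a - 1)
  have h3 := hmono hμ
  have h4 := h μ
  have := strictConcaveOn_sin_Icc.concaveOn.min_le_of_mem_Icc (z := -θ μ)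
    (hmem _ h2 h1) (Ioo_subset_Icc_self hβ) ⟨by linarith, by linarith⟩
  rw [min_comm, sin_neg (θ μ)] at this
  exact (this.trans (neg_le_abs _)).not_gt hsin

/-- The enumeration of the eigenvalues expressed through the Prüfer angle. -/
lemma exists_angle_eq_mul_pi_sub {q : ℝ → ℝ} (hq : IntervalIntegrable q volume 0 π) {α : ℝ}
    {M : ℕ → ℝ → ℝ}
    (hM : ∀ β ∈ Ico (0:ℝ) π, StrictMono (fun n => M n β) ∧
      ∀ μ : ℝ, IsEigenvalue q α β μ ↔ ∃ n : ℕ, μ = M n β) :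
    ∃ θ : ℝ → ℝ, StrictMono θ ∧ ∀ β ∈ Ico (0:ℝ) π, ∀ n, θ (M n β) = n * π - β := by
  have hπ := pi_pos
  have h0π : (0:ℝ) ∈ Ico (0:ℝ) π := ⟨le_rfl, hπ⟩
  obtain ⟨ψ, hψ, hψmono, hψeig, hψlow⟩ := exists_angle hq α
  obtain ⟨k, hk⟩ := sin_eq_zero_iff.1 ((hψeig 0 _).1 (((hM 0 h0π).2 _).2 ⟨0, rfl⟩))
  rw [add_zero] at hk
  obtain ⟨θ, hθdef⟩ : ∃ θ : ℝ → ℝ, ∀ μ, θ μ = ψ μ - k * π := ⟨_, fun _ => rfl⟩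
  have hθ : Continuous θ := by rw [funext hθdef]; fun_prop
  have hmono : StrictMono θ := fun x y hxy => by
    rw [hθdef, hθdef]; exact sub_lt_sub_right (hψmono hxy) _
  have hlow : ∀ c > 0, ∀ m, ∃ μ < m, |sin (θ μ)| < c := by
    intro c hc m
    obtain ⟨μ, hμ, h⟩ := hψlow c hc m
    refine ⟨μ, hμ, ?_⟩
    rwa [hθdef, sin_sub_int_mul_pi, abs_mul, abs_neg_one_zpow, one_mul]
  have hzero : ∀ β ∈ Ico (0:ℝ) π, ∀ μ, sin (θ μ + β) = 0 ↔ ∃ n : ℕ, μ = M n β := by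
    intro β hβ μ
    rw [← (hM β hβ).2, hψeig, hθdef, sub_add_eq_add_sub, sin_sub_int_mul_pi]
    simp [zpow_ne_zero]
  have hstep : ∀ β ∈ Ico (0:ℝ) π, ∀ n, θ (M n β) = θ (M 0 β) + n * π := fun β hβ =>
    angle_eq_add_mul_pi hθ hmono (hM β hβ).1 (hzero β hβ)
  have hbase : θ (M 0 0) = 0 := by rw [hθdef, ← hk, sub_self]
  refine ⟨θ, hmono, fun β hβ n => ?_⟩
  suffices h : θ (M 0 β) = -β by rw [hstep β hβ, h]; ring
  rcases hβ.1.eq_or_lt with rfl | hβ0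
  · rw [hbase, neg_zero]
  obtain ⟨j, hj⟩ := sin_eq_zero_iff.1 ((hzero β hβ _).2 ⟨0, rfl⟩)
  obtain ⟨μ, hμ⟩ := exists_angle_eq_neg hθ hmono hlow hbase ⟨hβ0, hβ.2⟩
  obtain ⟨i, rfl⟩ := (hzero β hβ μ).1 (by rw [hμ, neg_add_cancel, sin_zero])
  have hj0 : (j : ℝ) * π ≤ 0 := by
    have := hmono.monotone ((hM β hβ).1.monotone i.zero_le)
    linarith
  rcases hj0.eq_or_lt with hj0 | hj0
  · linarith
  have hj1 : (j : ℝ) ≤ -1 := by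
    have : j < 0 := by exact_mod_cast neg_of_mul_neg_left hj0 hπ.le
    exact_mod_cast Int.le_sub_one_of_lt this
  have hle : θ (M 0 β) ≤ -π := by nlinarith
  obtain ⟨x, -, hx⟩ := intermediate_value_Icc
    (hmono.le_iff_le.1 (by linarith : θ (M 0 β) ≤ θ (M 0 0))) hθ.continuousOn
    (⟨hle, by linarith⟩ : -π ∈ Icc (θ (M 0 β)) (θ (M 0 0)))
  obtain ⟨l, rfl⟩ := (hzero 0 h0π x).1 (by rw [hx, add_zero, sin_neg, sin_pi, neg_zero])
  rw [hstep 0 h0π, hbase] at hx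
  have : 0 ≤ (l : ℝ) * π := by positivity
  linarith

/-- For fixed `q` and `α`, if `M n β` enumerates the eigenvalues of `L(q, α, β)` in strictly
increasing order for each `β ∈ [0, π)`, then each `M n` is strictly decreasing and continuous
in `β` on `[0, π)`, and `μₙ(q,α,β) → μ_{n-1}(q,α,0)` as `β → π⁻` (for `n ≥ 1`). -/
theorem eigenvalue_strict_anti_continuous_in_beta
    (q : ℝ → ℝ) (hq : IntervalIntegrable q volume 0 π)
    (α : ℝ) (hα : α ∈ Ioc (0:ℝ) π)
    (M : ℕ → ℝ → ℝ)
    (hM : ∀ β ∈ Ico (0:ℝ) π, StrictMono (fun n => M n β) ∧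
      ∀ μ : ℝ, IsEigenvalue q α β μ ↔ ∃ n : ℕ, μ = M n β) :
    ∀ n : ℕ,
      StrictAntiOn (M n) (Ico (0:ℝ) π) ∧
      ContinuousOn (M n) (Ico (0:ℝ) π) ∧
      Filter.Tendsto (M (n + 1)) (nhdsWithin π (Iio π)) (nhds (M n 0)) := by
  obtain ⟨θ, hmono, hθ⟩ := exists_angle_eq_mul_pi_sub hq hM
  have h0π : (0:ℝ) ∈ Ico (0:ℝ) π := ⟨le_rfl, pi_pos⟩
  refine fun n => ⟨fun β hβ γ hγ hlt => ?_, fun β hβ => ?_, ?_⟩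
  · rw [← hmono.lt_iff_lt, hθ β hβ, hθ γ hγ]
    linarith
  · refine tendsto_of_strictMono_comp hmono ?_
    rw [hθ β hβ]
    refine Filter.Tendsto.congr' (f₁ := fun γ => n * π - γ) ?_ ?_
    · filter_upwards [self_mem_nhdsWithin] with γ hγ using (hθ γ hγ n).symm
    · exact (by fun_prop : Continuous fun γ : ℝ => n * π - γ).continuousWithinAt
  · refine tendsto_of_strictMono_comp hmono ?_
    rw [hθ 0 h0π, sub_zero]
    refine Filter.Tendsto.congr' (f₁ := fun γ => (n + 1 : ℕ) * π - γ) ?_ ?_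
    · filter_upwards [Ico_mem_nhdsLT pi_pos] with γ hγ using (hθ γ hγ _).symm
    · have h := (by fun_prop : Continuous fun γ : ℝ => (n + 1 : ℕ) * π - γ).continuousWithinAt
        (s := Iio π) (x := π)
      convert h.tendsto using 2
      push_cast
      ring
end
end

section
/- For fixed q ∈ L¹([0,π]; ℝ) and fixed β ∈ [0,π), the n-th eigenvalue μₙ(q, α, β) of L(q, α, β) is strictly increasing in α ∈ (0,π], and μₙ(q, π, β) = lim_{α→0⁺} μ_{n+1}(q, α, β). -/
open Real MeasureTheory Set

noncomputable section

/-- An integrable weight admits an exponential majorant `E` that turns `∫ w` into a contraction. -/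
theorem exists_weight_of_locallyIntegrable {w : ℝ → ℝ} (hw : ∀ a b, IntervalIntegrable w volume a b)
    (hw0 : ∀ t, 0 ≤ w t) (b : ℝ) :
    ∃ E : ℝ → ℝ, Continuous E ∧ (∀ x, 0 < E x) ∧ (∀ x ≤ b, 1 ≤ E x) ∧
      ∀ x ≤ b, 2 * ∫ t in x..b, w t * E t ≤ E x := by
  have hmono : Monotone fun x => ∫ t in b..x, w t := by
    intro x y hxy
    have := intervalIntegral.integral_add_adjacent_intervals (hw b x) (hw x y)
    have h2 := intervalIntegral.integral_nonneg hxy (fun t _ => hw0 t) (μ := volume)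
    simp only
    linarith
  have hcont : Continuous fun x => ∫ t in b..x, w t := intervalIntegral.continuous_primitive hw b
  refine ⟨fun x => Real.exp (-2 * ∫ t in b..x, w t), by fun_prop, fun x => Real.exp_pos _,
    fun x hx => ?_, fun x hx => ?_⟩
  · have h := hmono hx
    simp only [intervalIntegral.integral_same] at h
    exact Real.one_le_exp (by linarith)
  · set f : ℝ → ℝ := fun x => -Real.exp (-2 * ∫ t in b..x, w t) with hf
    have hfm : Monotone f := by
      intro x y hxy
      have := hmono hxy
      simp only [hf, neg_le_neg_iff, Real.exp_le_exp]
      simp only at this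
      linarith
    have h1 := (hfm.monotoneOn (uIcc x b)).intervalIntegral_deriv_mem_uIcc
    rw [uIcc_of_le (sub_nonneg.2 (hfm hx))] at h1
    have h2 : ∫ t in x..b, deriv f t = ∫ t in x..b, 2 * (w t * Real.exp (-2 * ∫ s in b..t, w s)) := by
      apply intervalIntegral.integral_congr_ae
      filter_upwards [(hw x b).ae_hasDerivAt_integral] with t ht htm
      have h3 := ht (uIoc_subset_uIcc htm) b (by simp)
      have h4 : HasDerivAt f _ t := ((h3.const_mul (-2)).exp).neg
      rw [HasDerivAt.deriv h4]
      ring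
    rw [h2, intervalIntegral.integral_const_mul] at h1
    have h5 := h1.2
    simp only [hf, intervalIntegral.integral_same, mul_zero, Real.exp_zero] at h5
    linarith

theorem intervalIntegrable_indicator_Icc {q : ℝ → ℝ} {a b : ℝ} (hab : a ≤ b)
    (hq : IntervalIntegrable q volume a b) (c d : ℝ) :
    IntervalIntegrable ((Icc a b).indicator q) volume c d := by
  apply Integrable.intervalIntegrable
  rw [integrable_indicator_iff measurableSet_Icc]
  exact (intervalIntegrable_iff_integrableOn_Icc_of_le hab).1 hq

theorem exists_weight {w : ℝ → ℝ} {a b : ℝ} (hab : a ≤ b) (hw : IntervalIntegrable w volume a b)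
    (hw0 : ∀ t, 0 ≤ w t) :
    ∃ E : ℝ → ℝ, Continuous E ∧ (∀ x, 0 < E x) ∧ (∀ x ≤ b, 1 ≤ E x) ∧
      ∀ x ∈ Icc a b, 2 * ∫ t in x..b, w t * E t ≤ E x := by
  obtain ⟨E, hE, hpos, hone, h⟩ := exists_weight_of_locallyIntegrable
    (intervalIntegrable_indicator_Icc hab hw) (fun t => indicator_nonneg (fun x _ => hw0 x) t) b
  refine ⟨E, hE, hpos, hone, fun x hx => ?_⟩
  rw [intervalIntegral.integral_congr (g := fun t => (Icc a b).indicator w t * E t)]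
  · exact h x hx.2
  · intro t ht
    rw [uIcc_of_le hx.2] at ht
    simp [indicator_of_mem (show t ∈ Icc a b from ⟨hx.1.trans ht.1, ht.2⟩)]

/-- A backward Grönwall inequality with an integrable kernel. -/
theorem exists_gronwall_bound {w : ℝ → ℝ} {a b : ℝ} (hab : a ≤ b)
    (hw : IntervalIntegrable w volume a b) (hw0 : ∀ t, 0 ≤ w t) :
    ∃ C : ℝ, 0 ≤ C ∧ ∀ (f : ℝ → ℝ) (c : ℝ), ContinuousOn f (Icc a b) → (∀ x, 0 ≤ f x) →
      (∀ x ∈ Icc a b, f x ≤ c + ∫ t in x..b, w t * f t) → ∀ x ∈ Icc a b, f x ≤ C * c := by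
  obtain ⟨E, hE, hpos, hone, h⟩ := exists_weight hab hw hw0
  obtain ⟨m, hm, hmax⟩ := isCompact_Icc.exists_isMaxOn (nonempty_Icc.2 hab) hE.continuousOn
  refine ⟨2 * E m, by linarith [hpos m], fun f c hf hf0 hfw x hx => ?_⟩
  obtain ⟨z, hz, hzmax⟩ := isCompact_Icc.exists_isMaxOn (nonempty_Icc.2 hab)
    (hf.div hE.continuousOn fun t _ => (hpos t).ne')
  set S := f z / E z with hS
  have hS0 : 0 ≤ S := div_nonneg (hf0 z) (hpos z).le
  have hfS : ∀ t ∈ Icc a b, f t ≤ S * E t := fun t ht => (div_le_iff₀ (hpos t)).1 (hzmax ht)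
  have hsub : uIcc z b ⊆ Icc a b := by rw [uIcc_of_le hz.2]; exact Icc_subset_Icc_left hz.1
  have hwz : IntervalIntegrable w volume z b :=
    hw.mono_set (by rwa [uIcc_of_le hab])
  have h1 : ∫ t in z..b, w t * f t ≤ ∫ t in z..b, S * (w t * E t) := by
    apply intervalIntegral.integral_mono_on hz.2 (hwz.mul_continuousOn (hf.mono hsub))
      ((hwz.mul_continuousOn hE.continuousOn).const_mul S)
    intro t ht
    have := mul_le_mul_of_nonneg_left (hfS t ⟨hz.1.trans ht.1, ht.2⟩) (hw0 t)
    linarith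
  rw [intervalIntegral.integral_const_mul] at h1
  have h2 := mul_le_mul_of_nonneg_left (h z hz) hS0
  have h3 := hfw z hz
  have h4 : f z = S * E z := by rw [hS, div_mul_cancel₀ _ (hpos z).ne']
  have h5 : S * E z ≤ 2 * c := by linarith
  have h6 : S ≤ 2 * c := (le_mul_of_one_le_right hS0 (hone z hz.2)).trans h5
  calc f x ≤ S * E x := hfS x hx
    _ ≤ S * E m := mul_le_mul_of_nonneg_left (hmax hx) hS0
    _ ≤ (2 * c) * E m := mul_le_mul_of_nonneg_right h6 (hpos m).le
    _ = _ := by ring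

theorem exists_lipschitz_volterra {w k E : ℝ → ℝ} {a b : ℝ} (hab : a ≤ b)
    (hw : IntervalIntegrable w volume a b) (hk : IntervalIntegrable k volume a b)
    (hkw : ∀ t, |k t| ≤ w t) (hE : Continuous E) (hpos : ∀ x, 0 < E x)
    (h : ∀ x ∈ Icc a b, 2 * ∫ t in x..b, w t * E t ≤ E x) (c : ℝ) :
    ∃ L : C(Icc a b, ℝ) → C(Icc a b, ℝ), LipschitzWith (1 / 2) L ∧
      ∀ v x, L v x = (E x)⁻¹ * (c - ∫ t in (x : ℝ)..b, k t * (E t * IccExtend hab v t)) := by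
  have hint : ∀ v : C(Icc a b, ℝ),
      IntervalIntegrable (fun t => k t * (E t * IccExtend hab v t)) volume a b := fun v =>
    hk.mul_continuousOn (hE.mul v.continuous.Icc_extend').continuousOn
  have hcont : ∀ v : C(Icc a b, ℝ), Continuous fun x : Icc a b =>
      (E x)⁻¹ * (c - ∫ t in (x : ℝ)..b, k t * (E t * IccExtend hab v t)) := by
    intro v
    have h1 := intervalIntegral.continuousOn_primitive_interval' (hint v) (right_mem_uIcc)
    rw [uIcc_of_le hab] at h1
    have h2 := continuousOn_iff_continuous_domRestrict.1 h1
    simp_rw [intervalIntegral.integral_symm b]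
    exact ((hE.comp continuous_subtype_val).inv₀ fun x => (hpos x.1).ne').mul
      (continuous_const.sub h2.neg)
  refine ⟨fun v => ⟨_, hcont v⟩, LipschitzWith.of_dist_le_mul fun v u => ?_, fun v x => rfl⟩
  rw [ContinuousMap.dist_le (by positivity)]
  intro x
  have hsub : uIcc (x : ℝ) b ⊆ uIcc a b := by
    rw [uIcc_of_le x.2.2, uIcc_of_le hab]; exact Icc_subset_Icc_left x.2.1
  have h1 : |∫ t in (x : ℝ)..b, k t * (E t * IccExtend hab v t) - k t * (E t * IccExtend hab u t)|
      ≤ ∫ t in (x : ℝ)..b, dist v u * (w t * E t) := by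
    rw [← Real.norm_eq_abs]
    refine intervalIntegral.norm_integral_le_of_norm_le x.2.2 (ae_of_all _ fun t _ => ?_)
      (((hw.mono_set hsub).mul_continuousOn hE.continuousOn).const_mul _)
    rw [← mul_sub, ← mul_sub, Real.norm_eq_abs, abs_mul, abs_mul, abs_of_pos (hpos t)]
    have h2 : |IccExtend hab v t - IccExtend hab u t| ≤ dist v u := by
      rw [← Real.dist_eq]
      exact ContinuousMap.dist_apply_le_dist _
    calc |k t| * (E t * |IccExtend hab v t - IccExtend hab u t|)
        ≤ w t * (E t * dist v u) := by
          have := hpos t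
          exact mul_le_mul (hkw t) (by gcongr) (by positivity) ((abs_nonneg _).trans (hkw t))
      _ = _ := by ring
  rw [intervalIntegral.integral_sub ((hint v).mono_set hsub) ((hint u).mono_set hsub),
    intervalIntegral.integral_const_mul] at h1
  have h2 := mul_le_mul_of_nonneg_left (h x x.2) (dist_nonneg (x := v) (y := u))
  simp only [ContinuousMap.coe_mk, Real.dist_eq, ← mul_sub, abs_mul]
  rw [abs_of_pos (inv_pos.2 (hpos x)), inv_mul_le_iff₀ (hpos x), sub_sub_sub_cancel_left, abs_sub_comm]
  simp only [NNReal.coe_div, NNReal.coe_one, NNReal.coe_ofNat]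
  linarith

theorem exists_linear_system_solution {r : ℝ → ℝ} {a b : ℝ} (hab : a ≤ b)
    (hr : IntervalIntegrable r volume a b) (c₁ c₂ : ℝ) :
    ∃ y z : ℝ → ℝ, Continuous y ∧ Continuous z ∧
      (∀ x ∈ Icc a b, y x = c₁ - ∫ t in x..b, z t) ∧
      (∀ x ∈ Icc a b, z x = c₂ - ∫ t in x..b, r t * y t) := by
  have hw : IntervalIntegrable (fun t => 1 + |r t|) volume a b := intervalIntegrable_const.add hr.abs
  obtain ⟨E, hE, hpos, -, h⟩ := exists_weight hab hw fun t => by positivity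
  obtain ⟨L₁, hL₁, h₁⟩ := exists_lipschitz_volterra (k := fun _ => 1) hab hw
    intervalIntegrable_const (fun t => by simp) hE hpos h c₁
  obtain ⟨L₂, hL₂, h₂⟩ := exists_lipschitz_volterra hab hw hr
    (fun t => by linarith [abs_nonneg (r t)]) hE hpos h c₂
  have hT : ContractingWith (1 / 2) fun v : C(Icc a b, ℝ) × C(Icc a b, ℝ) => (L₁ v.2, L₂ v.1) := by
    refine ⟨by rw [div_lt_one] <;> norm_num, ?_⟩
    simpa using (hL₁.comp LipschitzWith.prod_snd).prodMk (hL₂.comp LipschitzWith.prod_fst)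
  have hfix := hT.fixedPoint_isFixedPt
  set v := ContractingWith.fixedPoint _ hT
  obtain ⟨v₁, v₂⟩ := v
  obtain ⟨hv₁, hv₂⟩ := Prod.mk.inj hfix
  refine ⟨fun t => E t * IccExtend hab v₁ t, fun t => E t * IccExtend hab v₂ t,
    hE.mul v₁.continuous.Icc_extend', hE.mul v₂.continuous.Icc_extend', fun x hx => ?_,
    fun x hx => ?_⟩
  · have := h₁ v₂ ⟨x, hx⟩
    simp only at hv₁
    rw [hv₁] at this
    simp only [IccExtend_of_mem hab _ hx, this, mul_inv_cancel_left₀ (hpos x).ne', one_mul]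
  · have := h₂ v₁ ⟨x, hx⟩
    simp only at hv₂
    rw [hv₂] at this
    simp only [IccExtend_of_mem hab _ hx, this, mul_inv_cancel_left₀ (hpos x).ne']

theorem exists_slSol {q : ℝ → ℝ} (hq : IntervalIntegrable q volume 0 π) (μ c₁ c₂ : ℝ) :
    ∃ y y', SLSol q μ y y' ∧ y π = c₁ ∧ y' π = c₂ := by
  have hr : IntervalIntegrable (fun t => q t - μ) volume 0 π := hq.sub intervalIntegrable_const
  obtain ⟨y, z, hy, hz, h₁, h₂⟩ := exists_linear_system_solution pi_pos.le hr c₁ c₂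
  have hryi := hr.mul_continuousOn hy.continuousOn
  have h0 : (0 : ℝ) ∈ Icc 0 π := left_mem_Icc.2 pi_pos.le
  have hπ : π ∈ Icc (0 : ℝ) π := right_mem_Icc.2 pi_pos.le
  refine ⟨y, z, ⟨hy.continuousOn, hz.continuousOn, fun x hx => ?_, fun x hx => ?_⟩, ?_, ?_⟩
  · rw [h₁ x hx, h₁ 0 h0, ← intervalIntegral.integral_add_adjacent_intervals
      (hz.intervalIntegrable 0 x) (hz.intervalIntegrable x π)]
    ring
  · have hx' : x ∈ uIcc 0 π := by rwa [uIcc_of_le pi_pos.le]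
    rw [h₂ x hx, h₂ 0 h0, ← intervalIntegral.integral_add_adjacent_intervals
      (hryi.mono_set (uIcc_subset_uIcc_left hx')) (hryi.mono_set (uIcc_subset_uIcc_right hx'))]
    ring
  · simp [h₁ π hπ]
  · simp [h₂ π hπ]

theorem integral_add_mul_eq_sub_of_primitive {f g F G : ℝ → ℝ} {b : ℝ} (hb : 0 ≤ b)
    (hf : IntervalIntegrable f volume 0 b) (hg : IntervalIntegrable g volume 0 b)
    (hF : ∀ x ∈ Icc 0 b, F x = F 0 + ∫ t in (0 : ℝ)..x, f t)
    (hG : ∀ x ∈ Icc 0 b, G x = G 0 + ∫ t in (0 : ℝ)..x, g t) :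
    ∫ t in (0 : ℝ)..b, (f t * G t + F t * g t) = F b * G b - F 0 * G 0 := by
  have key : ∀ {h : ℝ → ℝ} (c : ℝ), IntervalIntegrable h volume 0 b →
      AbsolutelyContinuousOnInterval (fun x => c + ∫ t in (0 : ℝ)..x, h t) 0 b := by
    intro h c hh
    have h1 : AbsolutelyContinuousOnInterval (fun _ : ℝ => c) 0 b :=
      (contDiff_const.contDiffOn).absolutelyContinuousOnInterval
    exact h1.fun_add (hh.absolutelyContinuousOnInterval_intervalIntegral left_mem_uIcc)
  have h := (key (F 0) hf).integral_deriv_mul_eq_sub (key (G 0) hg)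
  rw [← hF b (right_mem_Icc.2 hb), ← hG b (right_mem_Icc.2 hb)] at h
  simp only [intervalIntegral.integral_same, add_zero] at h
  rw [← h]
  apply intervalIntegral.integral_congr_ae
  filter_upwards [hf.ae_hasDerivAt_integral, hg.ae_hasDerivAt_integral] with t hft hgt ht
  have ht' := uIoc_subset_uIcc ht
  have htm : t ∈ Icc 0 b := by rwa [uIcc_of_le hb] at ht'
  rw [((hft ht' 0 left_mem_uIcc).const_add (F 0)).deriv,
    ((hgt ht' 0 left_mem_uIcc).const_add (G 0)).deriv, hF t htm, hG t htm]

theorem IntervalIntegrable.sub_const_mul_continuousOn {q y : ℝ → ℝ}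
    (hq : IntervalIntegrable q volume 0 π) (μ : ℝ) (hy : ContinuousOn y (Icc 0 π)) :
    IntervalIntegrable (fun t => (q t - μ) * y t) volume 0 π :=
  (hq.sub intervalIntegrable_const).mul_continuousOn (by rwa [uIcc_of_le pi_pos.le])

theorem ContinuousOn.intervalIntegrable_zero_pi_s15 {y : ℝ → ℝ} (hy : ContinuousOn y (Icc 0 π)) :
    IntervalIntegrable y volume 0 π :=
  hy.intervalIntegrable_of_Icc pi_pos.le

theorem eq_sub_integral_right {f F : ℝ → ℝ} (hf : IntervalIntegrable f volume 0 π)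
    (hF : ∀ x ∈ Icc (0 : ℝ) π, F x = F 0 + ∫ t in (0 : ℝ)..x, f t) :
    ∀ x ∈ Icc (0 : ℝ) π, F x = F π - ∫ t in x..π, f t := by
  intro x hx
  have hx' : x ∈ uIcc 0 π := by rwa [uIcc_of_le pi_pos.le]
  rw [hF x hx, hF π (right_mem_Icc.2 pi_pos.le), ← intervalIntegral.integral_add_adjacent_intervals
    (hf.mono_set (uIcc_subset_uIcc_left hx')) (hf.mono_set (uIcc_subset_uIcc_right hx'))]
  ring

/-- Solutions of the inhomogeneous equation are controlled by their data at `π`, uniformly for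
bounded `μ`. -/
theorem exists_slSolInh_bound {q : ℝ → ℝ} (hq : IntervalIntegrable q volume 0 π) (R : ℝ) :
    ∃ C : ℝ, 0 ≤ C ∧ ∀ μ g y y', |μ| ≤ R → IntervalIntegrable g volume 0 π →
      SLSolInh q μ g y y' → ∀ x ∈ Icc (0 : ℝ) π,
        |y x| + |y' x| ≤ C * (|y π| + |y' π| + ∫ t in (0 : ℝ)..π, |g t|) := by
  have hw : IntervalIntegrable (fun t => 1 + |q t| + |R|) volume 0 π :=
    (intervalIntegrable_const.add hq.abs).add intervalIntegrable_const
  obtain ⟨C, hC, h⟩ := exists_gronwall_bound pi_pos.le hw fun t => by positivity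
  refine ⟨C, hC, fun μ g y y' hμ hg ⟨hy, hy', h₁, h₂⟩ => h (fun x => |y x| + |y' x|) _
    (hy.abs.add hy'.abs) (fun x => by positivity) fun x hx => ?_⟩
  have hsub : uIcc x π ⊆ uIcc 0 π := by
    rw [uIcc_of_le pi_pos.le, uIcc_of_le hx.2]; exact Icc_subset_Icc_left hx.1
  have hi := hq.sub_const_mul_continuousOn μ hy
  have hxy' := hy'.intervalIntegrable_zero_pi_s15.mono_set hsub
  have h3 := eq_sub_integral_right hy'.intervalIntegrable_zero_pi_s15 h₁ x hx
  have h4 := eq_sub_integral_right (hi.sub hg) h₂ x hx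
  have h5 : |y x| ≤ |y π| + ∫ t in x..π, |y' t| := by
    rw [h3]
    exact (abs_sub _ _).trans
      (by gcongr; exact intervalIntegral.abs_integral_le_integral_abs hx.2)
  have h6 : |y' x| ≤ |y' π| + ∫ t in x..π, (|(q t - μ) * y t| + |g t|) := by
    rw [h4]
    refine (abs_sub _ _).trans (add_le_add le_rfl ?_)
    refine (intervalIntegral.abs_integral_le_integral_abs hx.2).trans ?_
    exact intervalIntegral.integral_mono_on hx.2 ((hi.sub hg).mono_set hsub).abs
      ((hi.mono_set hsub).abs.add (hg.mono_set hsub).abs) fun t _ => abs_sub _ _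
  rw [intervalIntegral.integral_add (hi.mono_set hsub).abs (hg.mono_set hsub).abs] at h6
  have h7 : ∫ t in x..π, |g t| ≤ ∫ t in (0 : ℝ)..π, |g t| :=
    intervalIntegral.integral_mono_interval hx.1 hx.2 le_rfl
      (ae_of_all _ fun t => abs_nonneg _) hg.abs
  have h8 : (∫ t in x..π, |y' t|) + ∫ t in x..π, |(q t - μ) * y t| ≤
      ∫ t in x..π, (1 + |q t| + |R|) * (|y t| + |y' t|) := by
    rw [← intervalIntegral.integral_add hxy'.abs (hi.mono_set hsub).abs]
    refine intervalIntegral.integral_mono_on hx.2 (hxy'.abs.add (hi.mono_set hsub).abs)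
      ((hw.mul_continuousOn ?_).mono_set hsub) fun t _ => ?_
    · rw [uIcc_of_le pi_pos.le]
      exact hy.abs.add hy'.abs
    · rw [abs_mul]
      have h9 : |q t - μ| ≤ |q t| + |R| :=
        (abs_sub _ _).trans (add_le_add le_rfl (hμ.trans (le_abs_self R)))
      have h10 := mul_le_mul_of_nonneg_right h9 (abs_nonneg (y t))
      have h11 : 0 ≤ (|q t| + |R|) * |y' t| := by positivity
      linarith [abs_nonneg (y t)]
  linarith

theorem SLSol.sub {q : ℝ → ℝ} (hq : IntervalIntegrable q volume 0 π) {μ ν : ℝ} {y y' z z' : ℝ → ℝ}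
    (hy : SLSol q μ y y') (hz : SLSol q ν z z') :
    SLSolInh q ν (fun t => (ν - μ) * y t) (fun t => z t - y t) (fun t => z' t - y' t) := by
  obtain ⟨hy0, hy1, hy2, hy3⟩ := hy
  obtain ⟨hz0, hz1, hz2, hz3⟩ := hz
  refine ⟨hz0.sub hy0, hz1.sub hy1, fun x hx => ?_, fun x hx => ?_⟩ <;>
    have hsub : uIcc 0 x ⊆ uIcc 0 π := uIcc_subset_uIcc_left (by rwa [uIcc_of_le pi_pos.le])
  · beta_reduce
    rw [intervalIntegral.integral_sub (hz1.intervalIntegrable_zero_pi_s15.mono_set hsub)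
      (hy1.intervalIntegrable_zero_pi_s15.mono_set hsub), hz2 x hx, hy2 x hx]
    ring
  · beta_reduce
    rw [hz3 x hx, hy3 x hx, add_sub_add_comm, ← intervalIntegral.integral_sub
      ((hq.sub_const_mul_continuousOn ν hz0).mono_set hsub)
      ((hq.sub_const_mul_continuousOn μ hy0).mono_set hsub)]
    congr 2
    ext t
    ring

theorem SLSol.const_mul {q : ℝ → ℝ} {μ : ℝ} {y y' : ℝ → ℝ} (hy : SLSol q μ y y') (c : ℝ) :
    SLSol q μ (fun t => c * y t) (fun t => c * y' t) := by
  obtain ⟨hy0, hy1, hy2, hy3⟩ := hy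
  refine ⟨hy0.const_mul c, hy1.const_mul c, fun x hx => ?_, fun x hx => ?_⟩
  · beta_reduce
    rw [intervalIntegral.integral_const_mul, hy2 x hx]
    ring
  · beta_reduce
    simp_rw [mul_left_comm _ c]
    rw [intervalIntegral.integral_const_mul, hy3 x hx]
    ring

theorem SLSol.eqOn_of_eq_right {q : ℝ → ℝ} (hq : IntervalIntegrable q volume 0 π) {μ : ℝ}
    {y y' z z' : ℝ → ℝ} (hy : SLSol q μ y y') (hz : SLSol q μ z z') (h : z π = y π)
    (h' : z' π = y' π) : EqOn z y (Icc 0 π) ∧ EqOn z' y' (Icc 0 π) := by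
  obtain ⟨C, hC, hb⟩ := exists_slSolInh_bound hq |μ|
  have key := hb μ _ _ _ le_rfl (by simp) (hy.sub hq hz)
  simp only [h, h', sub_self, abs_zero, zero_mul, add_zero, intervalIntegral.integral_zero,
    mul_zero] at key
  constructor <;> intro x hx <;> have := key x hx <;> have h1 := abs_nonneg (z x - y x) <;>
    have h2 := abs_nonneg (z' x - y' x)
  · exact sub_eq_zero.1 (abs_eq_zero.1 (by linarith))
  · exact sub_eq_zero.1 (abs_eq_zero.1 (by linarith))

/-- Lagrange's identity. -/
theorem SLSol.wronskian_sub_wronskian {q : ℝ → ℝ} (hq : IntervalIntegrable q volume 0 π) {μ ν : ℝ}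
    {y y' z z' : ℝ → ℝ} (hy : SLSol q μ y y') (hz : SLSol q ν z z') :
    (y π * z' π - y' π * z π) - (y 0 * z' 0 - y' 0 * z 0) =
      (μ - ν) * ∫ t in (0 : ℝ)..π, y t * z t := by
  obtain ⟨hy0, hy1, hy2, hy3⟩ := hy
  obtain ⟨hz0, hz1, hz2, hz3⟩ := hz
  have hi := hq.sub_const_mul_continuousOn μ hy0
  have hj := hq.sub_const_mul_continuousOn ν hz0
  have h1 := integral_add_mul_eq_sub_of_primitive pi_pos.le hy1.intervalIntegrable_zero_pi_s15 hj hy2 hz3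
  have h2 := integral_add_mul_eq_sub_of_primitive pi_pos.le hi hz1.intervalIntegrable_zero_pi_s15 hy3 hz2
  have hu : uIcc 0 π = Icc 0 π := uIcc_of_le pi_pos.le
  have hc : IntervalIntegrable (fun t => y' t * z' t) volume 0 π :=
    (hy1.mul hz1).intervalIntegrable_zero_pi_s15
  have hzi : IntervalIntegrable (fun t => y t * ((q t - ν) * z t)) volume 0 π :=
    hj.continuousOn_mul (by rwa [hu])
  have hyi : IntervalIntegrable (fun t => (q t - μ) * y t * z t) volume 0 π :=
    hi.mul_continuousOn (by rwa [hu])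
  have h3 := intervalIntegral.integral_sub (hc.add hzi) (hyi.add hc)
  rw [h1, h2] at h3
  rw [← intervalIntegral.integral_const_mul, sub_sub_sub_comm]
  rw [sub_sub_sub_comm] at h3
  have h4 : ∀ t, y' t * z' t + y t * ((q t - ν) * z t) - ((q t - μ) * y t * z t + y' t * z' t) =
      (μ - ν) * (y t * z t) := fun t => by ring
  simp only [h4] at h3
  linarith

theorem sq_le_of_primitive {y y' : ℝ → ℝ} (hy : ContinuousOn y (Icc 0 π))
    (hy' : ContinuousOn y' (Icc 0 π))
    (h : ∀ x ∈ Icc (0 : ℝ) π, y x = y 0 + ∫ t in (0 : ℝ)..x, y' t) {ε : ℝ} (hε : 0 < ε) :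
    ∀ x ∈ Icc (0 : ℝ) π, y x ^ 2 ≤ 2 * ε * (∫ t in (0 : ℝ)..π, y' t ^ 2) +
      (2 * ε⁻¹ + π⁻¹) * ∫ t in (0 : ℝ)..π, y t ^ 2 := by
  have hy2 : IntervalIntegrable (fun t => y t ^ 2) volume 0 π :=
    (hy.pow 2).intervalIntegrable_zero_pi_s15
  have hy'2 : IntervalIntegrable (fun t => y' t ^ 2) volume 0 π :=
    (hy'.pow 2).intervalIntegrable_zero_pi_s15
  have hi := (hy'2.const_mul ε).add (hy2.const_mul ε⁻¹)
  have hyy' : IntervalIntegrable (fun t => y' t * y t + y t * y' t) volume 0 π :=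
    ((hy'.mul hy).add (hy.mul hy')).intervalIntegrable_zero_pi_s15
  have key : ∀ x ∈ Icc (0 : ℝ) π, |y x ^ 2 - y 0 ^ 2| ≤
      ε * (∫ t in (0 : ℝ)..π, y' t ^ 2) + ε⁻¹ * ∫ t in (0 : ℝ)..π, y t ^ 2 := by
    intro x hx
    have hsub : uIcc 0 x ⊆ uIcc 0 π := uIcc_subset_uIcc_left (by rwa [uIcc_of_le pi_pos.le])
    have hp : ∀ t ∈ Icc 0 x, y t = y 0 + ∫ s in (0 : ℝ)..t, y' s :=
      fun t ht => h t ⟨ht.1, ht.2.trans hx.2⟩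
    have hxi := hy'.intervalIntegrable_zero_pi_s15.mono_set hsub
    rw [pow_two, pow_two, ← integral_add_mul_eq_sub_of_primitive hx.1 hxi hxi hp hp,
      ← intervalIntegral.integral_const_mul, ← intervalIntegral.integral_const_mul,
      ← intervalIntegral.integral_add (hy'2.const_mul ε) (hy2.const_mul ε⁻¹)]
    refine (intervalIntegral.abs_integral_le_integral_abs hx.1).trans ?_
    refine (intervalIntegral.integral_mono_on hx.1 (hyy'.mono_set hsub).abs (hi.mono_set hsub)
      fun t _ => ?_).trans (intervalIntegral.integral_mono_interval le_rfl hx.1 hx.2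
        (ae_of_all _ fun t => ?_) hi)
    · rw [abs_le]
      have h1 : ε * y' t ^ 2 + ε⁻¹ * y t ^ 2 = ε⁻¹ * ((ε * y' t) ^ 2 + y t ^ 2) := by
        field_simp
      have h2 : y' t * y t + y t * y' t = ε⁻¹ * (2 * (ε * y' t) * y t) := by
        field_simp; ring
      rw [h1, h2, ← mul_neg]
      have := inv_pos.2 hε
      constructor <;> refine mul_le_mul_of_nonneg_left ?_ this.le <;>
        nlinarith [sq_nonneg (ε * y' t + y t), sq_nonneg (ε * y' t - y t)]
    · simp only [Pi.zero_apply]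
      positivity
  obtain ⟨z, hz, hmin⟩ := isCompact_Icc.exists_isMinOn (nonempty_Icc.2 pi_pos.le) (hy.pow 2)
  have h1 : π * y z ^ 2 ≤ ∫ t in (0 : ℝ)..π, y t ^ 2 := by
    have := intervalIntegral.integral_mono_on (μ := volume) pi_pos.le
      (intervalIntegrable_const (c := y z ^ 2)) hy2 (fun t ht => hmin ht)
    simpa using this
  have h2 : y z ^ 2 ≤ π⁻¹ * ∫ t in (0 : ℝ)..π, y t ^ 2 := by
    rwa [inv_mul_eq_div, le_div_iff₀ pi_pos, mul_comm]
  intro x hx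
  have h3 := (abs_le.1 (key x hx)).2
  have h4 := (abs_le.1 (key z hz)).1
  linarith

/-- For very negative `μ` there is no nontrivial solution whose logarithmic derivatives at the
endpoints are bounded. -/
theorem exists_forall_lt_slSol_eq_zero {q : ℝ → ℝ} (hq : IntervalIntegrable q volume 0 π) {K : ℝ}
    (hK : 0 ≤ K) : ∃ μ₀ : ℝ, ∀ μ < μ₀, ∀ y y', SLSol q μ y y' →
      |y 0 * y' 0| ≤ K * y 0 ^ 2 → |y π * y' π| ≤ K * y π ^ 2 → ∀ x ∈ Icc (0 : ℝ) π, y x = 0 := by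
  set Q := ∫ t in (0 : ℝ)..π, |q t| with hQdef
  have hQ : 0 ≤ Q := intervalIntegral.integral_nonneg pi_pos.le fun t _ => abs_nonneg _
  set N := 2 * K + Q + 1 with hN
  have hNpos : 0 < N := by linarith
  refine ⟨-(8 * N ^ 2 + N * π⁻¹), fun μ hμ y y' ⟨hy, hy', h₁, h₂⟩ hl hr => ?_⟩
  set A := ∫ t in (0 : ℝ)..π, y' t ^ 2 with hA
  set B := ∫ t in (0 : ℝ)..π, y t ^ 2 with hB
  have hA0 : 0 ≤ A := intervalIntegral.integral_nonneg pi_pos.le fun t _ => sq_nonneg _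
  have hB0 : 0 ≤ B := intervalIntegral.integral_nonneg pi_pos.le fun t _ => sq_nonneg _
  obtain ⟨m, hm, hmax⟩ := isCompact_Icc.exists_isMaxOn (nonempty_Icc.2 pi_pos.le) (hy.pow 2)
  replace hmax : ∀ x ∈ Icc (0 : ℝ) π, y x ^ 2 ≤ y m ^ 2 := fun x hx => hmax hx
  have hS := sq_le_of_primitive hy hy' h₁ (ε := (4 * N)⁻¹) (by positivity) m hm
  rw [inv_inv, ← hA, ← hB] at hS
  have hu : uIcc 0 π = Icc 0 π := uIcc_of_le pi_pos.le
  have hqy : IntervalIntegrable (fun t => q t * y t ^ 2) volume 0 π :=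
    hq.mul_continuousOn (by rw [hu]; exact hy.pow 2)
  have hy'2 : IntervalIntegrable (fun t => y' t ^ 2) volume 0 π :=
    (hy'.pow 2).intervalIntegrable_zero_pi_s15
  have hy2 : IntervalIntegrable (fun t => y t ^ 2) volume 0 π :=
    (hy.pow 2).intervalIntegrable_zero_pi_s15
  have hid := integral_add_mul_eq_sub_of_primitive pi_pos.le hy'.intervalIntegrable_zero_pi_s15
    (hq.sub_const_mul_continuousOn μ hy) h₁ h₂
  have hid2 : ∫ t in (0 : ℝ)..π, (y' t * y' t + y t * ((q t - μ) * y t)) =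
      A + ((∫ t in (0 : ℝ)..π, q t * y t ^ 2) - μ * B) := by
    rw [hA, hB, ← intervalIntegral.integral_const_mul,
      ← intervalIntegral.integral_sub hqy (hy2.const_mul μ),
      ← intervalIntegral.integral_add hy'2 (hqy.sub (hy2.const_mul μ))]
    congr 1
    ext t
    ring
  have hqS : |∫ t in (0 : ℝ)..π, q t * y t ^ 2| ≤ Q * y m ^ 2 := by
    refine (intervalIntegral.abs_integral_le_integral_abs pi_pos.le).trans ?_
    rw [hQdef, ← intervalIntegral.integral_mul_const]
    refine intervalIntegral.integral_mono_on pi_pos.le hqy.abs (hq.abs.mul_const _) fun t ht => ?_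
    rw [abs_mul, abs_of_nonneg (sq_nonneg (y t))]
    exact mul_le_mul_of_nonneg_left (hmax t ht) (abs_nonneg _)
  have hl' : K * y 0 ^ 2 ≤ K * y m ^ 2 :=
    mul_le_mul_of_nonneg_left (hmax 0 (left_mem_Icc.2 pi_pos.le)) hK
  have hr' : K * y π ^ 2 ≤ K * y m ^ 2 :=
    mul_le_mul_of_nonneg_left (hmax π (right_mem_Icc.2 pi_pos.le)) hK
  have h3 : A - μ * B ≤ N * y m ^ 2 := by
    have h4 := (abs_le.1 hqS).1
    have h5 := (abs_le.1 hl).1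
    have h6 := (abs_le.1 hr).2
    rw [hN]
    linarith [sq_nonneg (y m)]
  have h7 := mul_le_mul_of_nonneg_left hS hNpos.le
  have h8 : N * (2 * (4 * N)⁻¹ * A + (2 * (4 * N) + π⁻¹) * B) =
      A / 2 + (8 * N ^ 2 + N * π⁻¹) * B := by
    field_simp
    ring
  have h9 : A / 2 + (-(8 * N ^ 2 + N * π⁻¹) - μ) * B ≤ 0 := by linarith
  have hBz : B = 0 := by
    by_contra hne
    have := mul_pos (sub_pos.2 hμ) (lt_of_le_of_ne hB0 (Ne.symm hne))
    linarith
  have hAz : A = 0 := by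
    rw [hBz] at h9
    linarith
  intro x hx
  rw [hAz, hBz] at hS
  have := hmax x hx
  exact pow_eq_zero_iff two_ne_zero |>.1 (le_antisymm (by linarith) (sq_nonneg _))

theorem strictMono_of_eventually_lt {f : ℝ → ℝ} (hf : Continuous f)
    (h : ∀ x, ∀ᶠ y in nhdsWithin x (Ioi x), f x < f y) : StrictMono f := by
  intro a b hab
  obtain ⟨c, hc, hmax⟩ := isCompact_Icc.exists_isMaxOn (nonempty_Icc.2 hab.le) hf.continuousOn
  have key : ∀ x ∈ Icc a b, x < b → f x < f c := by
    intro x hx hxb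
    obtain ⟨y, hy, hyx⟩ := ((h x).and (Ioo_mem_nhdsGT hxb)).exists
    exact hy.trans_le (hmax ⟨hx.1.trans hyx.1.le, hyx.2.le⟩)
  rcases hc.2.lt_or_eq with hcb | rfl
  · exact absurd (key c hc hcb) (lt_irrefl _)
  · exact key a (left_mem_Icc.2 hab.le) hab

theorem exists_continuous_angle {F G : ℝ → ℝ} (hF : Continuous F) (hG : Continuous G)
    (h : ∀ μ, F μ ≠ 0 ∨ G μ ≠ 0) :
    ∃ φ r : ℝ → ℝ, Continuous φ ∧ ∀ μ, 0 < r μ ∧ F μ = -(r μ * Real.sin (φ μ)) ∧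
      G μ = r μ * Real.cos (φ μ) := by
  have hs : IsSimplyConnected (univ : Set ℝ) := by
    have := (convex_univ (𝕜 := ℝ) (E := ℝ)).contractibleSpace univ_nonempty
    exact SimplyConnectedSpace.ofContractible (univ : Set ℝ)
  obtain ⟨f, hf, hfe⟩ := Complex.exists_continuousOn_eqOn_exp_comp (X := ℝ) (U := univ)
    (g := fun μ => (G μ : ℂ) - F μ * Complex.I)
    hs isOpen_univ (by fun_prop) (by
      rintro ⟨μ, -, hμ⟩
      have h1 := congrArg Complex.re hμ
      have h2 := congrArg Complex.im hμ
      simp at h1 h2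
      rcases h μ with h | h <;> contradiction)
  rw [continuousOn_univ] at hf
  refine ⟨fun μ => (f μ).im, fun μ => Real.exp (f μ).re, by fun_prop, fun μ =>
    ⟨Real.exp_pos _, ?_, ?_⟩⟩
  · have := congrArg Complex.im (hfe (mem_univ μ))
    simp [Complex.exp_im] at this
    linarith
  · have := congrArg Complex.re (hfe (mem_univ μ))
    simp [Complex.exp_re] at this
    linarith

/-- If the levels `a + ℤ π` of a phase function are enumerated by `M · a` for every `a ∈ (0, π]`
and the phase accumulates only at multiples of `π` near `-∞`, then the enumeration starts at the
same level for all `a`. -/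
theorem exists_phase_eq {φ : ℝ → ℝ} (hφ : StrictMono φ) (hc : Continuous φ)
    (hlim : ∀ a₁ a₂, 0 < a₁ → a₂ < π → ∃ μ₀, ∀ μ < μ₀, ∀ j : ℤ, φ μ - j * π ∉ Icc a₁ a₂)
    {M : ℕ → ℝ → ℝ} (hM : ∀ a ∈ Ioc (0 : ℝ) π, StrictMono (fun n => M n a) ∧
      ∀ μ : ℝ, (∃ k : ℤ, φ μ = a + k * π) ↔ ∃ n : ℕ, μ = M n a) :
    ∃ j : ℤ, ∀ a ∈ Ioc (0 : ℝ) π, ∀ n : ℕ, φ (M n a) = a + (j + n) * π := by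
  have hπ := pi_pos
  have hπm : π ∈ Ioc (0 : ℝ) π := ⟨hπ, le_rfl⟩
  obtain ⟨hMm, hMe⟩ := hM π hπm
  choose k hk using fun n => (hMe (M n π)).2 ⟨n, rfl⟩
  have hkm : StrictMono k := by
    intro m n hmn
    have := hφ (hMm hmn)
    simp only [hk] at this
    have h1 : (k m : ℝ) < k n :=
      lt_of_mul_lt_mul_right (by linarith : (k m : ℝ) * π < k n * π) hπ.le
    exact_mod_cast h1
  have hk1 : ∀ n, k (n + 1) = k n + 1 := by
    intro n
    by_contra hne
    have h1 : k n + 1 < k (n + 1) :=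
      lt_of_le_of_ne (hkm (Nat.lt_succ_self n)) (Ne.symm hne)
    have h1' : (k n : ℝ) + 1 < k (n + 1) := by exact_mod_cast h1
    obtain ⟨ν, hν⟩ : π + ((k n + 1 : ℤ) : ℝ) * π ∈ range φ :=
      mem_range_of_exists_le_of_exists_ge hc ⟨M n π, by rw [hk]; push_cast; nlinarith⟩
        ⟨M (n + 1) π, by rw [hk]; push_cast; nlinarith⟩
    obtain ⟨i, rfl⟩ := (hMe ν).1 ⟨_, hν⟩
    have h2 : M n π < M i π := hφ.lt_iff_lt.1 (by rw [hk n, hν]; push_cast; nlinarith)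
    have h3 : M i π < M (n + 1) π := hφ.lt_iff_lt.1 (by rw [hk (n + 1), hν]; push_cast; nlinarith)
    have h4 := hMm.lt_iff_lt.1 h2
    have h5 := hMm.lt_iff_lt.1 h3
    omega
  have hkn : ∀ n, k n = k 0 + n := by
    intro n
    induction n with
    | zero => simp
    | succ n ih => rw [hk1, ih]; push_cast; ring
  have hφn : ∀ n : ℕ, φ (M n π) = π + (k 0 + n) * π := by
    intro n
    rw [hk, hkn]
    push_cast
    ring
  have hlow : ∀ μ, k 0 * π < φ μ := by
    intro μ
    by_contra! hle
    obtain ⟨ν, hν⟩ : (k 0 : ℝ) * π ∈ range φ :=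
      mem_range_of_exists_le_of_exists_ge hc ⟨μ, hle⟩ ⟨M 0 π, by rw [hk]; linarith⟩
    obtain ⟨i, rfl⟩ := (hMe ν).1 ⟨k 0 - 1, by rw [hν]; push_cast; ring⟩
    have h1 := hφ.monotone (hMm.monotone (Nat.zero_le i))
    simp only [hν, hk] at h1
    linarith
  have hinf : ∀ a ∈ Ioc (0 : ℝ) π, ∃ μ, φ μ ≤ a + k 0 * π := by
    intro a ha
    by_contra! hgt
    have h1 := hφ (sub_one_lt (M 0 π))
    rw [hk] at h1
    obtain ⟨μ₀, hμ₀⟩ := hlim a (φ (M 0 π - 1) - k 0 * π) ha.1 (by linarith)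
    refine hμ₀ (min (μ₀ - 1) (M 0 π - 1)) ((min_le_left _ _).trans_lt (sub_one_lt _)) (k 0)
      ⟨by linarith [hgt (min (μ₀ - 1) (M 0 π - 1))], ?_⟩
    linarith [hφ.monotone (min_le_right (μ₀ - 1) (M 0 π - 1))]
  refine ⟨k 0, fun a ha => ?_⟩
  obtain ⟨hm, he⟩ := hM a ha
  have hex : ∀ n : ℕ, ∃ μ, φ μ = a + (k 0 + n) * π := by
    intro n
    obtain ⟨μ, hμ⟩ := hinf a ha
    have hn : 0 ≤ (n : ℝ) * π := by positivity
    exact mem_range_of_exists_le_of_exists_ge hc ⟨μ, by linarith⟩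
      ⟨M n π, by rw [hφn]; linarith [ha.2]⟩
  choose e hφe using hex
  have hem : StrictMono e := by
    intro m n hmn
    have : (m : ℝ) < n := by exact_mod_cast hmn
    exact hφ.lt_iff_lt.1 (by rw [hφe, hφe]; nlinarith)
  have hrange : range e = range fun n => M n a := by
    ext μ
    constructor
    · rintro ⟨n, rfl⟩
      obtain ⟨i, hi⟩ := (he (e n)).1 ⟨k 0 + n, by rw [hφe]; push_cast; ring⟩
      exact ⟨i, hi.symm⟩
    · rintro ⟨n, rfl⟩
      obtain ⟨i, hi⟩ := (he (M n a)).2 ⟨n, rfl⟩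
      have h1 := hlow (M n a)
      have h2 : ((k 0 - 1 : ℤ) : ℝ) < i := by
        rw [hi] at h1
        push_cast
        exact lt_of_mul_lt_mul_right (by linarith [ha.2]) hπ.le
      have h3 : k 0 - 1 < i := by exact_mod_cast h2
      obtain ⟨m, hm'⟩ := Int.eq_ofNat_of_zero_le (show 0 ≤ i - k 0 by omega)
      refine ⟨m, hφ.injective ?_⟩
      rw [hφe, hi, show i = k 0 + m by omega]
      push_cast
      ring
  intro n
  rw [← hφe n, (hem.range_inj hm).1 hrange]

theorem strictMonoOn_and_tendsto_of_phase_eq {φ : ℝ → ℝ} (hφ : StrictMono φ) {M : ℕ → ℝ → ℝ} {j : ℤ}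
    (h : ∀ a ∈ Ioc (0 : ℝ) π, ∀ n : ℕ, φ (M n a) = a + (j + n) * π) (n : ℕ) :
    StrictMonoOn (M n) (Ioc (0 : ℝ) π) ∧
      Filter.Tendsto (M (n + 1)) (nhdsWithin 0 (Ioi 0)) (nhds (M n π)) := by
  have hn : φ (M n π) = (j + (n + 1 : ℕ)) * π := by
    rw [h π ⟨pi_pos, le_rfl⟩]
    push_cast
    ring
  refine ⟨fun a ha b hb hab => hφ.lt_iff_lt.1 (by rw [h a ha, h b hb]; linarith), ?_⟩
  rw [tendsto_order]
  constructor
  · intro ν hν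
    filter_upwards [Ioc_mem_nhdsGT pi_pos] with a ha
    refine hν.trans (hφ.lt_iff_lt.1 ?_)
    rw [hn, h a ha]
    linarith [ha.1]
  · intro ν hν
    filter_upwards [Ioc_mem_nhdsGT pi_pos, Ioo_mem_nhdsGT (sub_pos.2 (hφ hν))] with a ha ha'
    refine hφ.lt_iff_lt.1 ?_
    rw [h a ha, ← hn]
    linarith [ha'.2]


theorem SLSol.exists_ne_zero {q : ℝ → ℝ} {μ : ℝ} {y y' : ℝ → ℝ} (hy : SLSol q μ y y')
    (h : y π ≠ 0 ∨ y' π ≠ 0) : ∃ x ∈ Icc (0 : ℝ) π, y x ≠ 0 := by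
  by_contra! h0
  obtain ⟨-, -, h₁, h₂⟩ := hy
  have hπm : π ∈ Icc (0 : ℝ) π := right_mem_Icc.2 pi_pos.le
  have hconst : ∀ x ∈ Icc (0 : ℝ) π, y' x = y' 0 := by
    intro x hx
    rw [h₂ x hx, intervalIntegral.integral_congr (g := fun _ => (0 : ℝ))]
    · simp
    · intro t ht
      rw [uIcc_of_le hx.1] at ht
      simp [h0 t ⟨ht.1, ht.2.trans hx.2⟩]
  have hπ0 := h₁ π hπm
  rw [h0 π hπm, h0 0 (left_mem_Icc.2 pi_pos.le),
    intervalIntegral.integral_congr (g := fun _ => y' 0)] at hπ0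
  · simp [pi_ne_zero] at hπ0
    rcases h with h | h
    · exact h (h0 π hπm)
    · exact h ((hconst π hπm).trans hπ0)
  · intro t ht
    rw [uIcc_of_le pi_pos.le] at ht
    exact hconst t ht

theorem exists_lipschitz_slSol {q : ℝ → ℝ} (hq : IntervalIntegrable q volume 0 π) {c₁ c₂ : ℝ}
    {Y Y' : ℝ → ℝ → ℝ} (hY : ∀ μ, SLSol q μ (Y μ) (Y' μ)) (h₁ : ∀ μ, Y μ π = c₁)
    (h₂ : ∀ μ, Y' μ π = c₂) (μ : ℝ) :
    ∃ D, ∀ ν, |ν - μ| ≤ 1 → ∀ x ∈ Icc (0 : ℝ) π,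
      |Y ν x - Y μ x| ≤ D * |ν - μ| ∧ |Y' ν x - Y' μ x| ≤ D * |ν - μ| := by
  obtain ⟨C, -, hC⟩ := exists_slSolInh_bound hq (|μ| + 1)
  refine ⟨C * ∫ t in (0 : ℝ)..π, |Y μ t|, fun ν hν x hx => ?_⟩
  have hR : |ν| ≤ |μ| + 1 := by
    have := abs_add_le μ (ν - μ)
    rw [add_sub_cancel] at this
    linarith
  have hb := hC ν _ _ _ hR ((hY μ).1.intervalIntegrable_zero_pi_s15.const_mul (ν - μ))
    ((hY μ).sub hq (hY ν)) x hx
  simp only [h₁, h₂, sub_self, abs_zero, zero_add, abs_mul,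
    intervalIntegral.integral_const_mul] at hb
  have ha := abs_nonneg (Y ν x - Y μ x)
  have hb' := abs_nonneg (Y' ν x - Y' μ x)
  constructor <;> linarith

theorem continuous_slSol_zero {q : ℝ → ℝ} (hq : IntervalIntegrable q volume 0 π) {c₁ c₂ : ℝ}
    {Y Y' : ℝ → ℝ → ℝ} (hY : ∀ μ, SLSol q μ (Y μ) (Y' μ)) (h₁ : ∀ μ, Y μ π = c₁)
    (h₂ : ∀ μ, Y' μ π = c₂) :
    (Continuous fun μ => Y μ 0) ∧ Continuous fun μ => Y' μ 0 := by
  constructor <;> refine continuous_iff_continuousAt.2 fun μ => ?_ <;>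
    obtain ⟨D, hD⟩ := exists_lipschitz_slSol hq hY h₁ h₂ μ <;>
    refine continuousAt_of_locally_lipschitz one_pos D fun ν hν => ?_ <;>
    rw [Real.dist_eq] at hν ⊢ <;>
    have := hD ν hν.le 0 (left_mem_Icc.2 pi_pos.le)
  · exact this.1
  · exact this.2

theorem eventually_wronskian_pos {q : ℝ → ℝ} (hq : IntervalIntegrable q volume 0 π) {c₁ c₂ : ℝ}
    {Y Y' : ℝ → ℝ → ℝ} (hY : ∀ μ, SLSol q μ (Y μ) (Y' μ)) (h₁ : ∀ μ, Y μ π = c₁)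
    (h₂ : ∀ μ, Y' μ π = c₂) (hc : c₁ ≠ 0 ∨ c₂ ≠ 0) (μ : ℝ) :
    ∀ᶠ ν in nhdsWithin μ (Ioi μ), 0 < Y μ 0 * Y' ν 0 - Y' μ 0 * Y ν 0 := by
  have hcont : ContinuousAt (fun ν => ∫ t in (0 : ℝ)..π, Y μ t * Y ν t) μ := by
    obtain ⟨D, hD⟩ := exists_lipschitz_slSol hq hY h₁ h₂ μ
    refine continuousAt_of_locally_lipschitz one_pos ((∫ t in (0 : ℝ)..π, |Y μ t|) * D)
      fun ν hν => ?_
    rw [Real.dist_eq] at hν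
    have hμi : ∀ η, IntervalIntegrable (fun t => Y μ t * Y η t) volume 0 π := fun η =>
      ((hY μ).1.mul (hY η).1).intervalIntegrable_zero_pi_s15
    rw [Real.dist_eq, Real.dist_eq, ← intervalIntegral.integral_sub (hμi ν) (hμi μ)]
    refine (intervalIntegral.abs_integral_le_integral_abs pi_pos.le).trans ?_
    rw [mul_assoc, ← intervalIntegral.integral_mul_const]
    refine intervalIntegral.integral_mono_on pi_pos.le ((hμi ν).sub (hμi μ)).abs
      ((hY μ).1.intervalIntegrable_zero_pi_s15.abs.mul_const _) fun t ht => ?_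
    rw [← mul_sub, abs_mul]
    exact mul_le_mul_of_nonneg_left (hD ν hν.le t ht).1 (abs_nonneg _)
  have hpos : 0 < ∫ t in (0 : ℝ)..π, Y μ t * Y μ t := by
    obtain ⟨x, hx, hne⟩ := (hY μ).exists_ne_zero (by rwa [h₁, h₂])
    exact intervalIntegral.integral_pos pi_pos ((hY μ).1.mul (hY μ).1)
      (fun t _ => mul_self_nonneg _) ⟨x, hx, mul_self_pos.2 hne⟩
  filter_upwards [nhdsWithin_le_nhds (hcont.eventually_const_lt hpos), self_mem_nhdsWithin]
    with ν hν hlt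
  have hW := SLSol.wronskian_sub_wronskian hq (hY μ) (hY ν)
  rw [h₁, h₂, h₁, h₂] at hW
  have := mul_pos (sub_pos.2 hlt) hν
  linarith

theorem slSol_zero_ne_zero {q : ℝ → ℝ} (hq : IntervalIntegrable q volume 0 π) {μ : ℝ}
    {y y' : ℝ → ℝ} (hy : SLSol q μ y y') (h : y π ≠ 0 ∨ y' π ≠ 0) : y 0 ≠ 0 ∨ y' 0 ≠ 0 := by
  obtain ⟨z, z', hz, hzπ, hz'π⟩ := exists_slSol hq μ (-y' π) (y π)
  have hW := SLSol.wronskian_sub_wronskian hq hy hz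
  rw [hzπ, hz'π, sub_self, zero_mul] at hW
  by_contra! h0
  rw [h0.1, h0.2] at hW
  have : y π = 0 ∧ y' π = 0 := by constructor <;> nlinarith [sq_nonneg (y π), sq_nonneg (y' π)]
  tauto

theorem isEigenvalue_iff {q : ℝ → ℝ} (hq : IntervalIntegrable q volume 0 π) {a β μ : ℝ}
    {y y' : ℝ → ℝ} (hy : SLSol q μ y y') (h₁ : y π = Real.sin β) (h₂ : y' π = -Real.cos β) :
    IsEigenvalue q a β μ ↔ y 0 * Real.cos a + y' 0 * Real.sin a = 0 := by
  have hsc := Real.sin_sq_add_cos_sq β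
  constructor
  · rintro ⟨z, z', hz, ⟨x, hx, hne⟩, h0, hπ⟩
    set c := z π * Real.sin β - z' π * Real.cos β with hc
    obtain ⟨he, he'⟩ := (hy.const_mul c).eqOn_of_eq_right hq hz
      (by rw [h₁, hc]; linear_combination (-z π) * hsc + Real.cos β * hπ)
      (by rw [h₂, hc]; linear_combination (-z' π) * hsc + Real.sin β * hπ)
    have h0m : (0 : ℝ) ∈ Icc 0 π := left_mem_Icc.2 pi_pos.le
    have hc0 : c ≠ 0 := by
      intro hc0
      apply hne
      simp [he hx, hc0]
    rw [he h0m, he' h0m] at h0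
    refine (mul_eq_zero.1 (?_ : c * _ = 0)).resolve_left hc0
    linear_combination h0
  · intro h0
    refine ⟨y, y', hy, hy.exists_ne_zero ?_, h0, by rw [h₁, h₂]; ring⟩
    rw [h₁, h₂]
    by_contra! h
    rw [h.1, neg_eq_zero.1 h.2] at hsc
    norm_num at hsc

theorem min_sin_le_abs_sin {a₁ a₂ x : ℝ} (h₁ : 0 < a₁) (h₂ : a₂ < π) {j : ℤ}
    (hx : x - j * π ∈ Icc a₁ a₂) : min (Real.sin a₁) (Real.sin a₂) ≤ |Real.sin x| := by
  have ha := hx.1.trans hx.2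
  have h := strictConcaveOn_sin_Icc.concaveOn.min_le_of_mem_Icc
    ⟨h₁.le, ha.trans h₂.le⟩ ⟨h₁.le.trans ha, h₂.le⟩ hx
  refine h.trans ((le_abs_self _).trans_eq ?_)
  rw [Real.sin_sub_int_mul_pi, abs_mul, abs_zpow, abs_neg, abs_one, one_zpow, one_mul]

theorem exists_forall_lt_angle_notMem {q : ℝ → ℝ} (hq : IntervalIntegrable q volume 0 π) {c₁ c₂ : ℝ}
    {Y Y' : ℝ → ℝ → ℝ} (hY : ∀ μ, SLSol q μ (Y μ) (Y' μ)) (h₁ : ∀ μ, Y μ π = c₁)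
    (h₂ : ∀ μ, Y' μ π = c₂) (hc : c₁ ≠ 0 ∨ c₂ ≠ 0) {φ r : ℝ → ℝ}
    (hφ : ∀ μ, 0 < r μ ∧ Y μ 0 = -(r μ * Real.sin (φ μ)) ∧ Y' μ 0 = r μ * Real.cos (φ μ))
    {a₁ a₂ : ℝ} (ha₁ : 0 < a₁) (ha₂ : a₂ < π) :
    ∃ μ₀, ∀ μ < μ₀, ∀ j : ℤ, φ μ - j * π ∉ Icc a₁ a₂ := by
  set s := min (Real.sin a₁) (Real.sin a₂) with hs
  obtain ⟨μ₀, hμ₀⟩ := exists_forall_lt_slSol_eq_zero hq (K := |s|⁻¹ + |c₂ / c₁|) (by positivity)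
  refine ⟨μ₀, fun μ hμ j hj => ?_⟩
  have ha := hj.1.trans hj.2
  have hs0 : 0 < s := lt_min (sin_pos_of_pos_of_lt_pi ha₁ (ha.trans_lt ha₂))
    (sin_pos_of_pos_of_lt_pi (ha₁.trans_le ha) ha₂)
  obtain ⟨x, hx, hne⟩ := (hY μ).exists_ne_zero (by rwa [h₁, h₂])
  refine hne (hμ₀ μ hμ _ _ (hY μ) ?_ ?_ x hx)
  · obtain ⟨hr, hF, hG⟩ := hφ μ
    have hsin := min_sin_le_abs_sin ha₁ ha₂ hj
    rw [← hs] at hsin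
    have h3 : |Y' μ 0| ≤ s⁻¹ * |Y μ 0| := by
      rw [hF, hG, abs_neg, abs_mul, abs_mul, abs_of_pos hr]
      have h4 : 1 ≤ s⁻¹ * |Real.sin (φ μ)| := by
        rwa [inv_mul_eq_div, one_le_div hs0]
      have := mul_le_mul_of_nonneg_left ((Real.abs_cos_le_one (φ μ)).trans h4) hr.le
      linarith
    have h5 := mul_le_mul_of_nonneg_left h3 (abs_nonneg (Y μ 0))
    rw [abs_mul, abs_of_pos hs0, add_mul, ← sq_abs]
    have h6 : 0 ≤ |c₂ / c₁| * |Y μ 0| ^ 2 := by positivity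
    linarith
  · rw [h₁, h₂]
    rcases eq_or_ne c₁ 0 with rfl | h
    · simp
    · have h3 : |c₁ * c₂| = |c₂ / c₁| * c₁ ^ 2 := by
        rw [← sq_abs c₁, abs_div, abs_mul]
        field_simp
      rw [h3, add_mul]
      linarith [show 0 ≤ |s|⁻¹ * c₁ ^ 2 by positivity]

theorem strictMono_angle {F G φ r : ℝ → ℝ} (hφc : Continuous φ)
    (hφ : ∀ μ, 0 < r μ ∧ F μ = -(r μ * Real.sin (φ μ)) ∧ G μ = r μ * Real.cos (φ μ))
    (hW : ∀ μ, ∀ᶠ ν in nhdsWithin μ (Ioi μ), 0 < F μ * G ν - G μ * F ν) : StrictMono φ := by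
  refine strictMono_of_eventually_lt hφc fun μ => ?_
  have hnear : ∀ᶠ ν in nhdsWithin μ (Ioi μ), φ μ - π < φ ν :=
    nhdsWithin_le_nhds (hφc.continuousAt.eventually_const_lt (sub_lt_self _ pi_pos))
  filter_upwards [hW μ, hnear] with ν hν hlt
  obtain ⟨hr, hF, hG⟩ := hφ μ
  obtain ⟨hr', hF', hG'⟩ := hφ ν
  by_contra! hle
  have h1 := Real.sin_nonpos_of_nonpos_of_neg_pi_le (sub_nonpos.2 hle) (by linarith)
  have h2 : F μ * G ν - G μ * F ν = r μ * r ν * Real.sin (φ ν - φ μ) := by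
    rw [hF, hG, hF', hG', Real.sin_sub]
    ring
  rw [h2] at hν
  exact hν.not_ge (mul_nonpos_of_nonneg_of_nonpos (by positivity) h1)

/-- For fixed `q` and `β`, if `M n a` enumerates the eigenvalues of `L(q, a, β)` in strictly
increasing order for each `a ∈ (0, π]`, then each `M n` is strictly increasing in `a` on
`(0, π]`, and `μₙ(q, π, β) = lim_{a → 0⁺} μ_{n+1}(q, a, β)`. -/
theorem eigenvalue_strict_mono_in_alpha
    (q : ℝ → ℝ) (hq : IntervalIntegrable q volume 0 π)
    (β : ℝ) (hβ : β ∈ Ico (0:ℝ) π)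
    (M : ℕ → ℝ → ℝ)
    (hM : ∀ a ∈ Ioc (0:ℝ) π, StrictMono (fun n => M n a) ∧
      ∀ μ : ℝ, IsEigenvalue q a β μ ↔ ∃ n : ℕ, μ = M n a) :
    ∀ n : ℕ,
      StrictMonoOn (M n) (Ioc (0:ℝ) π) ∧
      Filter.Tendsto (M (n + 1)) (nhdsWithin 0 (Ioi 0)) (nhds (M n π)) := by
  have hc : Real.sin β ≠ 0 ∨ -Real.cos β ≠ 0 := by
    by_contra! h
    have := Real.sin_sq_add_cos_sq β
    rw [h.1, neg_eq_zero.1 h.2] at this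
    norm_num at this
  choose Y Y' hY h₁ h₂ using fun μ => exists_slSol hq μ (Real.sin β) (-Real.cos β)
  obtain ⟨hF, hG⟩ := continuous_slSol_zero hq hY h₁ h₂
  obtain ⟨φ, r, hφc, hφ⟩ := exists_continuous_angle hF hG fun μ =>
    slSol_zero_ne_zero hq (hY μ) (by rwa [h₁, h₂])
  have hmono := strictMono_angle hφc hφ (eventually_wronskian_pos hq hY h₁ h₂ hc)
  obtain ⟨j, hj⟩ := exists_phase_eq hmono hφc
    (fun a₁ a₂ ha₁ ha₂ => exists_forall_lt_angle_notMem hq hY h₁ h₂ hc hφ ha₁ ha₂)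
    (M := M) fun a ha => ⟨(hM a ha).1, fun μ => by
      rw [← (hM a ha).2 μ, isEigenvalue_iff hq (hY μ) (h₁ μ) (h₂ μ)]
      obtain ⟨hr, hFμ, hGμ⟩ := hφ μ
      have hsin : Y μ 0 * Real.cos a + Y' μ 0 * Real.sin a = -(r μ * Real.sin (φ μ - a)) := by
        rw [hFμ, hGμ, Real.sin_sub]
        ring
      rw [hsin, neg_eq_zero, mul_eq_zero, or_iff_right hr.ne', Real.sin_eq_zero_iff]
      exact exists_congr fun k => by rw [eq_comm (b := φ μ - a), sub_eq_iff_eq_add']⟩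
  exact strictMonoOn_and_tendsto_of_phase_eq hmono hj
end
end
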